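/- arXiv:2411.08479 — 3 statements merged into one kernel-verified Lean document; each statement's English description precedes it below -/
import Mathlib

section
/- Every positive semidefinite ternary quartic form over the real numbers is a sum of three squares of quadratic forms: if f ∈ ℝ[x,y,z] is homogeneous of degree 4 and f(a) ≥ 0 for every a ∈ ℝ³, then there exist homogeneous polynomials q₁, q₂, q₃ ∈ ℝ[x,y,z] of degree 2 such that f = q₁² + q₂² + q₃². -/
open MvPolynomial

namespace TernaryQuartic

open Matrix Module Set Filter Topology

section LinearAlgebra

lemma exists_root_monic_cubic (a b c : ℝ) : ∃ t : ℝ, t ^ 3 + a * t ^ 2 + b * t + c = 0 := by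
  set M : ℝ := 1 + |a| + |b| + |c| with hM
  have ha := abs_nonneg a
  have hb := abs_nonneg b
  have hc := abs_nonneg c
  have hM1 : 1 ≤ M := by linarith
  have hM2 : M ≤ M ^ 2 := by nlinarith
  have hbound : |a| * M ^ 2 + |b| * M + |c| ≤ M ^ 3 := by
    have h1 : |b| * M ≤ |b| * M ^ 2 := mul_le_mul_of_nonneg_left hM2 hb
    have h2 : |c| * 1 ≤ |c| * M ^ 2 := mul_le_mul_of_nonneg_left (hM1.trans hM2) hc
    have h3 : M ^ 3 = (1 + |a| + |b| + |c|) * M ^ 2 := by rw [← hM]; ring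
    nlinarith [sq_nonneg M]
  have hlow : (-M) ^ 3 + a * (-M) ^ 2 + b * (-M) + c ≤ 0 := by
    nlinarith [mul_le_mul_of_nonneg_right (le_abs_self a) (sq_nonneg M),
      mul_le_mul_of_nonneg_right (neg_abs_le b) (zero_le_one.trans hM1), le_abs_self c]
  have hhigh : 0 ≤ M ^ 3 + a * M ^ 2 + b * M + c := by
    nlinarith [mul_le_mul_of_nonneg_right (neg_abs_le a) (sq_nonneg M),
      mul_le_mul_of_nonneg_right (neg_abs_le b) (zero_le_one.trans hM1), neg_abs_le c]
  obtain ⟨t, -, ht⟩ := intermediate_value_Icc (by linarith : -M ≤ M)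
    (f := fun t : ℝ => t ^ 3 + a * t ^ 2 + b * t + c) (by fun_prop) ⟨hlow, hhigh⟩
  exact ⟨t, ht⟩

lemma exists_left_eigenvector (X : Matrix (Fin 3) (Fin 3) ℝ) :
    ∃ χ : Fin 3 → ℝ, χ ≠ 0 ∧ ∃ s : ℝ, χ ᵥ* X = s • χ := by
  obtain ⟨s, hs⟩ := exists_root_monic_cubic (-(X 0 0 + X 1 1 + X 2 2))
    (X 0 0 * X 1 1 - X 0 1 * X 1 0 + X 0 0 * X 2 2 - X 0 2 * X 2 0 + X 1 1 * X 2 2 - X 1 2 * X 2 1)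
    (-X.det)
  have hdet : (X - s • (1 : Matrix (Fin 3) (Fin 3) ℝ)).det = 0 := by
    rw [det_fin_three] at hs ⊢
    simp
    linear_combination -hs
  obtain ⟨χ, hχ, h⟩ := exists_vecMul_eq_zero_iff.mpr hdet
  refine ⟨χ, hχ, s, ?_⟩
  rwa [vecMul_sub, vecMul_smul, vecMul_one, sub_eq_zero] at h

/-- If the commutator of `X` and `Y` is annihilated by a nonzero row vector `w` as well as by
`w X` and `w Y`, then some nontrivial combination `X' = α X + β Y` has a left eigenvector `χ`
whose image under the complementary combination `α Y - β X` lies in the same eigenspace. -/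
lemma exists_common_eigen {X Y : Matrix (Fin 3) (Fin 3) ℝ} {w : Fin 3 → ℝ} (hw : w ≠ 0)
    (h0 : w ᵥ* (X * Y) = w ᵥ* (Y * X))
    (h1 : (w ᵥ* X) ᵥ* (X * Y) = (w ᵥ* X) ᵥ* (Y * X))
    (h2 : (w ᵥ* Y) ᵥ* (X * Y) = (w ᵥ* Y) ᵥ* (Y * X)) :
    ∃ χ : Fin 3 → ℝ, χ ≠ 0 ∧ ∃ α β s : ℝ, ¬(α = 0 ∧ β = 0) ∧
      χ ᵥ* (α • X + β • Y) = s • χ ∧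
      (χ ᵥ* (α • Y - β • X)) ᵥ* (α • X + β • Y) = s • (χ ᵥ* (α • Y - β • X)) := by
  have key : ∀ χ : Fin 3 → ℝ, ∀ α β s : ℝ, χ ᵥ* (X * Y) = χ ᵥ* (Y * X) →
      χ ᵥ* (α • X + β • Y) = s • χ →
      (χ ᵥ* (α • Y - β • X)) ᵥ* (α • X + β • Y) = s • (χ ᵥ* (α • Y - β • X)) := by
    intro χ α β s hc he
    have : χ ᵥ* ((α • Y - β • X) * (α • X + β • Y)) =
        χ ᵥ* ((α • X + β • Y) * (α • Y - β • X)) := by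
      simp only [sub_mul, mul_add, add_mul, mul_sub, smul_mul_assoc, mul_smul_comm,
        vecMul_add, vecMul_sub, vecMul_smul, hc]
      module
    rw [vecMul_vecMul, this, ← vecMul_vecMul, he, smul_vecMul]
  by_cases hli : LinearIndependent ℝ ![w, w ᵥ* X, w ᵥ* Y]
  · have hcomm : X * Y = Y * X := by
      have hspan := hli.span_eq_top_of_card_eq_finrank (by simp)
      have : ∀ v : Fin 3 → ℝ, v ᵥ* (X * Y) = v ᵥ* (Y * X) := by
        intro v
        have hv : v ∈ Submodule.span ℝ (range ![w, w ᵥ* X, w ᵥ* Y]) := by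
          rw [hspan]; trivial
        obtain ⟨c, rfl⟩ := (Submodule.mem_span_range_iff_exists_fun ℝ).mp hv
        simp only [Fin.sum_univ_three, add_vecMul, smul_vecMul, cons_val_zero, cons_val_one,
          cons_val]
        rw [h0, h1, h2]
      ext i j
      simpa using congrFun (this (Pi.single i 1)) j
    obtain ⟨χ, hχ, s, hs⟩ := exists_left_eigenvector X
    have he : χ ᵥ* ((1 : ℝ) • X + (0 : ℝ) • Y) = s • χ := by simpa using hs
    exact ⟨χ, hχ, 1, 0, s, by simp, he, key χ 1 0 s (by rw [hcomm]) he⟩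
  · obtain ⟨g, hg, i, hi⟩ := Fintype.not_linearIndependent_iff.mp hli
    simp only [Fin.sum_univ_three, cons_val_zero, cons_val_one, cons_val] at hg
    have he : w ᵥ* (g 1 • X + g 2 • Y) = (-g 0) • w := by
      rw [vecMul_add, vecMul_smul, vecMul_smul, neg_smul, eq_neg_iff_add_eq_zero, ← hg]
      abel
    refine ⟨w, hw, g 1, g 2, -g 0, ?_, he, key w _ _ _ h0 he⟩
    rintro ⟨hg1, hg2⟩
    rw [hg1, hg2, zero_smul, zero_smul, add_zero, add_zero] at hg
    have hg0 := (smul_eq_zero.mp hg).resolve_right hw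
    fin_cases i <;> simp_all

/-- Two vectors orthogonal to two independent vectors of `ℝ³` are proportional. -/
lemma exists_smul_of_orthogonal {c d l w : Fin 3 → ℝ} (hcd : LinearIndependent ℝ ![c, d])
    (hl : l ≠ 0) (hlc : c ⬝ᵥ l = 0) (hld : d ⬝ᵥ l = 0) (hwc : c ⬝ᵥ w = 0) (hwd : d ⬝ᵥ w = 0) :
    ∃ t : ℝ, w = t • l := by
  have hne := crossProduct_ne_zero_iff_linearIndependent.mpr hcd
  have key : ∀ v : Fin 3 → ℝ, c ⬝ᵥ v = 0 → d ⬝ᵥ v = 0 → ∃ r : ℝ, r • (crossProduct c d) = v := by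
    intro v hc hd
    by_contra! h
    have h1 := (LinearIndependent.pair_iff' hne).mpr h
    apply crossProduct_ne_zero_iff_linearIndependent.mpr h1
    rw [cross_cross_eq_smul_sub_smul, hc, hd]
    simp
  obtain ⟨r, rfl⟩ := key l hlc hld
  obtain ⟨t, rfl⟩ := key w hwc hwd
  have hr : r ≠ 0 := by
    rintro rfl
    simp at hl
  exact ⟨t / r, by rw [smul_smul, div_mul_cancel₀ _ hr]⟩

end LinearAlgebra

section Forms

/-- Coefficients of `x², y², z², xy, yz, xz` in a ternary quadratic form. -/
abbrev Quad := Fin 6 → ℝ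

/-- Coefficients of `x⁴, y⁴, z⁴, x³y, x³z, y³x, y³z, z³x, z³y, x²y², y²z², x²z², x²yz, xy²z, xyz²`
in a ternary quartic form. -/
abbrev Quart := Fin 15 → ℝ

/-- The value of a quadratic form at a point. -/
def evalQuad (q : Quad) (v : Fin 3 → ℝ) : ℝ :=
  q 0 * v 0 ^ 2 + q 1 * v 1 ^ 2 + q 2 * v 2 ^ 2 + q 3 * (v 0 * v 1) + q 4 * (v 1 * v 2) +
    q 5 * (v 0 * v 2)

/-- The value of a quartic form at a point. -/
def evalQuart (f : Quart) (v : Fin 3 → ℝ) : ℝ :=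
  f 0 * v 0 ^ 4 + f 1 * v 1 ^ 4 + f 2 * v 2 ^ 4 + f 3 * (v 0 ^ 3 * v 1) + f 4 * (v 0 ^ 3 * v 2) +
    f 5 * (v 1 ^ 3 * v 0) + f 6 * (v 1 ^ 3 * v 2) + f 7 * (v 2 ^ 3 * v 0) +
    f 8 * (v 2 ^ 3 * v 1) + f 9 * (v 0 ^ 2 * v 1 ^ 2) + f 10 * (v 1 ^ 2 * v 2 ^ 2) +
    f 11 * (v 0 ^ 2 * v 2 ^ 2) + f 12 * (v 0 ^ 2 * v 1 * v 2) + f 13 * (v 0 * v 1 ^ 2 * v 2) +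
    f 14 * (v 0 * v 1 * v 2 ^ 2)

/-- The product of two linear forms. -/
def mulLin : (Fin 3 → ℝ) →ₗ[ℝ] (Fin 3 → ℝ) →ₗ[ℝ] Quad :=
  LinearMap.mk₂ ℝ
    (fun u v => ![u 0 * v 0, u 1 * v 1, u 2 * v 2, u 0 * v 1 + u 1 * v 0, u 1 * v 2 + u 2 * v 1,
      u 0 * v 2 + u 2 * v 0])
    (by intros; ext i; fin_cases i <;> simp <;> ring)
    (by intros; ext i; fin_cases i <;> simp <;> ring)
    (by intros; ext i; fin_cases i <;> simp <;> ring)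
    (by intros; ext i; fin_cases i <;> simp <;> ring)

lemma mulLin_apply (u v : Fin 3 → ℝ) :
    mulLin u v = ![u 0 * v 0, u 1 * v 1, u 2 * v 2, u 0 * v 1 + u 1 * v 0,
      u 1 * v 2 + u 2 * v 1, u 0 * v 2 + u 2 * v 0] := rfl

/-- The product of two quadratic forms. -/
def mulQuad : Quad →ₗ[ℝ] Quad →ₗ[ℝ] Quart :=
  LinearMap.mk₂ ℝ
    (fun p q => ![p 0 * q 0, p 1 * q 1, p 2 * q 2,
      p 0 * q 3 + p 3 * q 0, p 0 * q 5 + p 5 * q 0, p 1 * q 3 + p 3 * q 1,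
      p 1 * q 4 + p 4 * q 1, p 2 * q 5 + p 5 * q 2, p 2 * q 4 + p 4 * q 2,
      p 0 * q 1 + p 1 * q 0 + p 3 * q 3, p 1 * q 2 + p 2 * q 1 + p 4 * q 4,
      p 0 * q 2 + p 2 * q 0 + p 5 * q 5,
      p 0 * q 4 + p 4 * q 0 + p 3 * q 5 + p 5 * q 3,
      p 1 * q 5 + p 5 * q 1 + p 3 * q 4 + p 4 * q 3,
      p 2 * q 3 + p 3 * q 2 + p 4 * q 5 + p 5 * q 4])
    (by intros; ext i; fin_cases i <;> simp <;> ring)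
    (by intros; ext i; fin_cases i <;> simp <;> ring)
    (by intros; ext i; fin_cases i <;> simp <;> ring)
    (by intros; ext i; fin_cases i <;> simp <;> ring)

lemma mulQuad_apply (p q : Quad) :
    mulQuad p q = ![p 0 * q 0, p 1 * q 1, p 2 * q 2,
      p 0 * q 3 + p 3 * q 0, p 0 * q 5 + p 5 * q 0, p 1 * q 3 + p 3 * q 1,
      p 1 * q 4 + p 4 * q 1, p 2 * q 5 + p 5 * q 2, p 2 * q 4 + p 4 * q 2,
      p 0 * q 1 + p 1 * q 0 + p 3 * q 3, p 1 * q 2 + p 2 * q 1 + p 4 * q 4,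
      p 0 * q 2 + p 2 * q 0 + p 5 * q 5,
      p 0 * q 4 + p 4 * q 0 + p 3 * q 5 + p 5 * q 3,
      p 1 * q 5 + p 5 * q 1 + p 3 * q 4 + p 4 * q 3,
      p 2 * q 3 + p 3 * q 2 + p 4 * q 5 + p 5 * q 4] := rfl

lemma mulLin_comm (u v : Fin 3 → ℝ) : mulLin u v = mulLin v u := by
  ext i; fin_cases i <;> simp [mulLin_apply] <;> ring

lemma mulQuad_comm (p q : Quad) : mulQuad p q = mulQuad q p := by
  ext i; fin_cases i <;> simp [mulQuad_apply] <;> ring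

lemma mulQuad_mulLin_swap (u v w t : Fin 3 → ℝ) :
    mulQuad (mulLin u v) (mulLin w t) = mulQuad (mulLin u w) (mulLin v t) := by
  ext i; fin_cases i <;> simp [mulLin_apply, mulQuad_apply] <;> ring

lemma evalQuad_mulLin (u v x : Fin 3 → ℝ) :
    evalQuad (mulLin u v) x = (u ⬝ᵥ x) * (v ⬝ᵥ x) := by
  simp [evalQuad, mulLin_apply, dotProduct, Fin.sum_univ_three]; ring

lemma evalQuart_mulQuad (p q : Quad) (x : Fin 3 → ℝ) :
    evalQuart (mulQuad p q) x = evalQuad p x * evalQuad q x := by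
  simp [evalQuart, evalQuad, mulQuad_apply]; ring

lemma evalQuad_add (p q : Quad) (x : Fin 3 → ℝ) :
    evalQuad (p + q) x = evalQuad p x + evalQuad q x := by
  simp [evalQuad]; ring

lemma evalQuad_smul (c : ℝ) (p : Quad) (x : Fin 3 → ℝ) :
    evalQuad (c • p) x = c * evalQuad p x := by
  simp [evalQuad]; ring

lemma evalQuart_add (f g : Quart) (x : Fin 3 → ℝ) :
    evalQuart (f + g) x = evalQuart f x + evalQuart g x := by
  simp [evalQuart]; ring

lemma evalQuart_smul (c : ℝ) (f : Quart) (x : Fin 3 → ℝ) :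
    evalQuart (c • f) x = c * evalQuart f x := by
  simp [evalQuart]; ring

/-- A linear functional on quartic forms vanishing on all products of four coordinates is zero. -/
lemma functional_eq_zero (L : Quart →ₗ[ℝ] ℝ)
    (h : ∀ u v w t : Fin 3 → ℝ, L (mulQuad (mulLin u v) (mulLin w t)) = 0) : L = 0 := by
  set x : Fin 3 → ℝ := ![1, 0, 0] with hx
  set y : Fin 3 → ℝ := ![0, 1, 0] with hy
  set z : Fin 3 → ℝ := ![0, 0, 1] with hz
  refine LinearMap.ext fun f => ?_
  have hf : f = f 0 • mulQuad (mulLin x x) (mulLin x x) +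
      f 1 • mulQuad (mulLin y y) (mulLin y y) +
      f 2 • mulQuad (mulLin z z) (mulLin z z) +
      f 3 • mulQuad (mulLin x x) (mulLin x y) +
      f 4 • mulQuad (mulLin x x) (mulLin x z) +
      f 5 • mulQuad (mulLin y y) (mulLin y x) +
      f 6 • mulQuad (mulLin y y) (mulLin y z) +
      f 7 • mulQuad (mulLin z z) (mulLin z x) +
      f 8 • mulQuad (mulLin z z) (mulLin z y) +
      f 9 • mulQuad (mulLin x x) (mulLin y y) +
      f 10 • mulQuad (mulLin y y) (mulLin z z) +
      f 11 • mulQuad (mulLin x x) (mulLin z z) +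
      f 12 • mulQuad (mulLin x x) (mulLin y z) +
      f 13 • mulQuad (mulLin y y) (mulLin x z) +
      f 14 • mulQuad (mulLin z z) (mulLin x y) := by
    ext i
    fin_cases i <;> simp [hx, hy, hz, mulLin_apply, mulQuad_apply]
  rw [hf]
  simp only [map_add, map_smul, h, smul_zero, add_zero, LinearMap.zero_apply]

end Forms

section CommonLine

/-- Let `W` contain the forms `xᵢ² - xₖ a`, `xᵢ xⱼ - xₖ b` and `xⱼ² - xₖ c`, which have no common
real zero. If a nonzero functional on quartic forms kills all multiples of `W`, then two
independent members of `W` share a linear factor. -/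
lemma exists_common_factor {i j k : Fin 3} (hij : i ≠ j) (hik : i ≠ k) (hjk : j ≠ k)
    {W : Submodule ℝ Quad} {a b c : Fin 3 → ℝ}
    (hii_mem : mulLin (Pi.single i 1) (Pi.single i 1) - mulLin (Pi.single k 1) a ∈ W)
    (hij_mem : mulLin (Pi.single i 1) (Pi.single j 1) - mulLin (Pi.single k 1) b ∈ W)
    (hjj_mem : mulLin (Pi.single j 1) (Pi.single j 1) - mulLin (Pi.single k 1) c ∈ W)
    (hzero : ∀ v : Fin 3 → ℝ, v i * v i = v k * (a ⬝ᵥ v) → v i * v j = v k * (b ⬝ᵥ v) →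
      v j * v j = v k * (c ⬝ᵥ v) → v = 0)
    {L : Quart →ₗ[ℝ] ℝ} (hL : L ≠ 0) (hLW : ∀ q ∈ W, ∀ h, L (mulQuad q h) = 0) :
    ∃ l : Fin 3 → ℝ, l ≠ 0 ∧ ∃ m n : Fin 3 → ℝ, LinearIndependent ℝ ![m, n] ∧
      mulLin l m ∈ W ∧ mulLin l n ∈ W := by
  have hsum : ∀ g : Fin 3 → ℝ, ∑ r, g r = g i + g j + g k := by
    intro g
    have : (Finset.univ : Finset (Fin 3)) = {i, j, k} := by
      clear * - hij hik hjk
      revert i j k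
      decide
    rw [this, Finset.sum_insert (by simp [hij, hik]), Finset.sum_insert (by simp [hjk]),
      Finset.sum_singleton, add_assoc]
  set ei : Fin 3 → ℝ := Pi.single i 1 with hei
  set ej : Fin 3 → ℝ := Pi.single j 1 with hej
  set ek : Fin 3 → ℝ := Pi.single k 1 with hek
  have hbasis : ∀ v : Fin 3 → ℝ, v = v i • ei + v j • ej + v k • ek := by
    intro v
    ext r
    have hr : r = i ∨ r = j ∨ r = k := by
      clear * - hij hik hjk
      revert i j k r
      decide
    rcases hr with rfl | rfl | rfl <;>
      simp [hei, hej, hek, hij, hik, hjk, hij.symm, hik.symm, hjk.symm]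
  let X : Matrix (Fin 3) (Fin 3) ℝ := Matrix.of fun r t =>
    if t = i then a r else if t = j then b r else ei r
  let Y : Matrix (Fin 3) (Fin 3) ℝ := Matrix.of fun r t =>
    if t = i then b r else if t = j then c r else ej r
  have hXv : ∀ v, X *ᵥ v = v i • a + v j • b + v k • ei := by
    intro v
    ext r
    simp only [mulVec, dotProduct, hsum, X, Matrix.of_apply]
    simp [hij.symm, hik.symm, hjk.symm]
    ring
  have hYv : ∀ v, Y *ᵥ v = v i • b + v j • c + v k • ej := by
    intro v
    ext r
    simp only [mulVec, dotProduct, hsum, Y, Matrix.of_apply]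
    simp [hij.symm, hik.symm, hjk.symm]
    ring
  have hXW : ∀ v, mulLin ei v - mulLin ek (X *ᵥ v) ∈ W := by
    intro v
    have : mulLin ei v - mulLin ek (X *ᵥ v) =
        v i • (mulLin ei ei - mulLin ek a) + v j • (mulLin ei ej - mulLin ek b) := by
      rw [hXv]
      conv_lhs => rw [hbasis v]
      simp only [map_add, map_smul, mulLin_comm ek ei]
      simp [hei, hej, hek, hij, hik, hjk, hij.symm, hik.symm, hjk.symm]
      module
    rw [this]
    exact W.add_mem (W.smul_mem _ hii_mem) (W.smul_mem _ hij_mem)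
  have hYW : ∀ v, mulLin ej v - mulLin ek (Y *ᵥ v) ∈ W := by
    intro v
    have : mulLin ej v - mulLin ek (Y *ᵥ v) =
        v i • (mulLin ei ej - mulLin ek b) + v j • (mulLin ej ej - mulLin ek c) := by
      rw [hYv]
      conv_lhs => rw [hbasis v]
      simp only [map_add, map_smul, mulLin_comm ek ej, mulLin_comm ei ej]
      simp [hei, hej, hek, hij, hik, hjk, hij.symm, hik.symm, hjk.symm]
      module
    rw [this]
    exact W.add_mem (W.smul_mem _ hij_mem) (W.smul_mem _ hjj_mem)
  let T : (Fin 3 → ℝ) → (Fin 3 → ℝ) → (Fin 3 → ℝ) → (Fin 3 → ℝ) → ℝ :=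
    fun u v w t => L (mulQuad (mulLin u v) (mulLin w t))
  have hT12 : ∀ u v w t, T u v w t = T v u w t := fun u v w t => by simp only [T, mulLin_comm u v]
  have hT23 : ∀ u v w t, T u v w t = T u w v t := fun u v w t => by
    simp only [T, mulQuad_mulLin_swap u v w t]
  have hTX : ∀ u w v, T u w ek (X *ᵥ v) = T u w ei v := by
    intro u w v
    have := hLW _ (hXW v) (mulLin u w)
    rw [mulQuad_comm, map_sub, map_sub, sub_eq_zero] at this
    exact this.symm
  have hTY : ∀ u w v, T u w ek (Y *ᵥ v) = T u w ej v := by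
    intro u w v
    have := hLW _ (hYW v) (mulLin u w)
    rw [mulQuad_comm, map_sub, map_sub, sub_eq_zero] at this
    exact this.symm
  let lam : Fin 3 → ℝ := fun r => T ek ek ek (Pi.single r 1)
  have hlam : ∀ v, lam ⬝ᵥ v = T ek ek ek v := by
    intro v
    conv_rhs => rw [hbasis v]
    simp only [dotProduct, hsum, lam, T, map_add, map_smul, smul_eq_mul]
    ring
  have hlam0 : lam ≠ 0 := by
    intro h0
    have h1 : ∀ u w, (∀ v, T u w ek v = 0) → ∀ t v, T u w t v = 0 := by
      intro u w h t v
      have hi := h (X *ᵥ v)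
      have hj := h (Y *ᵥ v)
      have hk := h v
      rw [hTX] at hi
      rw [hTY] at hj
      rw [hbasis t]
      simp only [T] at hi hj hk ⊢
      simp [hi, hj, hk]
    have h2 := h1 ek ek fun v => by rw [← hlam, h0, zero_dotProduct]
    have h3 := fun t => h1 ek t fun v => by rw [hT23]; exact h2 t v
    have h4 := fun t s => h1 t s fun v => by rw [hT23, hT12]; exact h3 t s v
    exact hL (functional_eq_zero L h4)
  have hcomm : ∀ p v, T p ek ek (X *ᵥ (Y *ᵥ v)) = T p ek ek (Y *ᵥ (X *ᵥ v)) := by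
    intro p v
    rw [hTX, hT23, hTY, hTY, hT23 p ek ej, hTX, hT23]
  obtain ⟨χ, hχ, α, β, s, hαβ, hχX, hχY⟩ := exists_common_eigen (X := X) (Y := Y) hlam0
    (dotProduct_eq _ _ fun v => by
      simp only [← vecMul_vecMul, ← dotProduct_mulVec, hlam]
      rw [hcomm])
    (dotProduct_eq _ _ fun v => by
      simp only [← vecMul_vecMul, ← dotProduct_mulVec, hlam]
      rw [hTX, hTX, hT23, hT12, hcomm, hT12 ei, hT23])
    (dotProduct_eq _ _ fun v => by
      simp only [← vecMul_vecMul, ← dotProduct_mulVec, hlam]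
      rw [hTY, hTY, hT23, hT12, hcomm, hT12 ej, hT23])
  set ν := χ ᵥ* (α • Y - β • X) with hν
  have hD : α ^ 2 + β ^ 2 ≠ 0 := by
    intro h
    exact hαβ ⟨by nlinarith [sq_nonneg α, sq_nonneg β], by nlinarith [sq_nonneg α, sq_nonneg β]⟩
  by_cases hli : LinearIndependent ℝ ![χ, ν]
  · set l : Fin 3 → ℝ := α • ei + β • ej - s • ek with hldef
    have hlk : (α • X + β • Y) *ᵥ ek - s • ek = l := by
      rw [add_mulVec, smul_mulVec, smul_mulVec, hXv, hYv]
      simp [hek, hik, hjk, hldef]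
    have horth : ∀ v w : Fin 3 → ℝ, w ᵥ* (α • X + β • Y) = s • w →
        w ⬝ᵥ ((α • X + β • Y) *ᵥ v - s • v) = 0 := by
      intro v w hw
      rw [dotProduct_sub, dotProduct_mulVec, hw, dotProduct_smul, smul_dotProduct, sub_self]
    have hl0 : l ≠ 0 := by
      intro h
      have h1 := congrFun h i
      have h2 := congrFun h j
      simp [hldef, hei, hej, hek, hij, hik, hjk, hij.symm] at h1 h2
      exact hαβ ⟨h1, h2⟩
    have hμ : ∀ v : Fin 3 → ℝ, ∃ μ : ℝ, (α • X + β • Y) *ᵥ v - s • v = μ • l := fun v =>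
      exists_smul_of_orthogonal hli hl0 (hlk ▸ horth ek χ hχX) (hlk ▸ horth ek ν hχY)
        (horth v χ hχX) (horth v ν hχY)
    have hmem : ∀ (v : Fin 3 → ℝ) (μ : ℝ), (α • X + β • Y) *ᵥ v - s • v = μ • l →
        mulLin l (v - μ • ek) ∈ W := by
      intro v μ h
      have h1 := W.add_mem (W.smul_mem α (hXW v)) (W.smul_mem β (hYW v))
      convert h1 using 1
      have h2 := congrArg (mulLin ek) h
      simp only [add_mulVec, smul_mulVec, map_sub, map_add, map_smul, mulLin_comm ek l] at h2
      rw [map_sub, map_smul, ← h2]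
      simp only [hldef, map_sub, map_add, map_smul, LinearMap.sub_apply, LinearMap.add_apply,
        LinearMap.smul_apply]
      module
    obtain ⟨μ, h1⟩ := hμ ei
    obtain ⟨μ', h2⟩ := hμ ej
    refine ⟨l, hl0, ei - μ • ek, ej - μ' • ek, ?_, hmem _ _ h1, hmem _ _ h2⟩
    rw [LinearIndependent.pair_iff]
    intro x y hxy
    have h1 := congrFun hxy i
    have h2 := congrFun hxy j
    simpa [hei, hej, hek, hij, hik, hjk, hij.symm] using And.intro h1 h2
  · exfalso
    rw [LinearIndependent.pair_iff' hχ] at hli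
    push Not at hli
    obtain ⟨t, ht⟩ := hli
    rw [hν, vecMul_sub, vecMul_smul, vecMul_smul] at ht
    rw [vecMul_add, vecMul_smul, vecMul_smul] at hχX
    have hx : χ ᵥ* X = ((α * s - β * t) / (α ^ 2 + β ^ 2)) • χ := by
      ext r
      have h1 := congrFun ht r
      have h2 := congrFun hχX r
      simp at h1 h2 ⊢
      field_simp
      linear_combination α * h2 + β * h1
    have hy : χ ᵥ* Y = ((β * s + α * t) / (α ^ 2 + β ^ 2)) • χ := by
      ext r
      have h1 := congrFun ht r
      have h2 := congrFun hχX r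
      simp at h1 h2 ⊢
      field_simp
      linear_combination β * h2 - α * h1
    generalize (α * s - β * t) / (α ^ 2 + β ^ 2) = ξ at hx
    generalize (β * s + α * t) / (α ^ 2 + β ^ 2) = η at hy
    have hxv : ∀ v, χ ⬝ᵥ (X *ᵥ v) = ξ * (χ ⬝ᵥ v) := fun v => by
      rw [dotProduct_mulVec, hx, smul_dotProduct, smul_eq_mul]
    have hyv : ∀ v, χ ⬝ᵥ (Y *ᵥ v) = η * (χ ⬝ᵥ v) := fun v => by
      rw [dotProduct_mulVec, hy, smul_dotProduct, smul_eq_mul]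
    have x1 := hxv ei
    have x2 := hxv ej
    have x3 := hxv ek
    have y1 := hyv ei
    have y2 := hyv ej
    have y3 := hyv ek
    rw [hXv] at x1 x2 x3
    rw [hYv] at y1 y2 y3
    simp [hei, hej, hek, hij, hik, hjk, hij.symm, hik.symm, hjk.symm] at x1 x2 x3 y1 y2 y3
    refine hχ (hzero χ ?_ ?_ ?_)
    · rw [dotProduct_comm, x1, x3]; ring
    · rw [dotProduct_comm, x2, x3]; ring
    · rw [dotProduct_comm, y2, y3]; ring

end CommonLine

section Degenerate

/-- The square of a quadratic form. -/
def sq (q : Quad) : Quart := mulQuad q q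

/-- The sum of the squares of three quadratic forms. -/
def sumSq (p : Fin 3 → Quad) : Quart := ∑ n, sq (p n)

lemma eq_zero_of_mulLin_eq_zero {l m : Fin 3 → ℝ} (hl : l ≠ 0) (h : mulLin l m = 0) : m = 0 := by
  rw [mulLin_apply] at h
  have h0 := congrFun h 0
  have h1 := congrFun h 1
  have h2 := congrFun h 2
  have h3 := congrFun h 3
  have h4 := congrFun h 4
  have h5 := congrFun h 5
  simp at h0 h1 h2 h3 h4 h5
  obtain ⟨r, hr⟩ := Function.ne_iff.mp hl
  ext s
  fin_cases r <;> fin_cases s <;> simp_all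

lemma sumSq_eq_of_orthonormal (p : Fin 3 → Quad) {u v : Fin 3 → ℝ} (hu : u ⬝ᵥ u = 1)
    (hv : v ⬝ᵥ v = 1) (huv : u ⬝ᵥ v = 0) :
    ∃ g : Quad, sumSq p = sq (∑ n, u n • p n) + sq (∑ n, v n • p n) + sq g := by
  set w := crossProduct u v with hw
  have hO : (Matrix.of ![u, v, w]) * (Matrix.of ![u, v, w])ᵀ = 1 := by
    have huw : u ⬝ᵥ w = 0 := dot_self_cross u v
    have hvw : v ⬝ᵥ w = 0 := dot_cross_self u v
    have hww : w ⬝ᵥ w = 1 := by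
      rw [hw, cross_dot_cross, hu, hv, huv, dotProduct_comm v u, huv]; norm_num
    ext r s
    have : ((Matrix.of ![u, v, w]) * (Matrix.of ![u, v, w])ᵀ) r s =
        ![u, v, w] r ⬝ᵥ ![u, v, w] s := rfl
    rw [this]
    fin_cases r <;> fin_cases s <;> simp [hu, hv, huv, huw, hvw, hww, dotProduct_comm v u,
      dotProduct_comm w u, dotProduct_comm w v]
  have hO' := mul_eq_one_comm.mp hO
  have e : ∀ m n, u m * u n + v m * v n + w m * w n = (1 : Matrix (Fin 3) (Fin 3) ℝ) m n := by
    intro m n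
    rw [← hO', Matrix.mul_apply, Fin.sum_univ_three]
    simp
  refine ⟨∑ n, w n • p n, ?_⟩
  have e00 := e 0 0
  have e11 := e 1 1
  have e22 := e 2 2
  have e01 := e 0 1
  have e02 := e 0 2
  have e12 := e 1 2
  simp at e00 e11 e22 e01 e02 e12
  simp only [sumSq, sq, Fin.sum_univ_three, map_add, map_smul, LinearMap.add_apply,
    LinearMap.smul_apply, mulQuad_comm (p 1) (p 0), mulQuad_comm (p 2) (p 0),
    mulQuad_comm (p 2) (p 1)]
  linear_combination (norm := module) -(e00 • mulQuad (p 0) (p 0)) - e11 • mulQuad (p 1) (p 1) -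
    e22 • mulQuad (p 2) (p 2) - (2 : ℝ) • e01 • mulQuad (p 0) (p 1) -
    (2 : ℝ) • e02 • mulQuad (p 0) (p 2) - (2 : ℝ) • e12 • mulQuad (p 1) (p 2)

lemma dotProduct_self_pos {w : Fin 3 → ℝ} (hw : w ≠ 0) : 0 < w ⬝ᵥ w :=
  lt_of_le_of_ne (Finset.sum_nonneg fun _ _ => mul_self_nonneg _)
    (Ne.symm (mt dotProduct_self_eq_zero.mp hw))

lemma sumSq_eq_of_linearIndependent (p : Fin 3 → Quad) {w w' : Fin 3 → ℝ}
    (h : LinearIndependent ℝ ![w, w']) :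
    ∃ a b c : ℝ, a ≠ 0 ∧ ∃ g : Quad, sumSq p = sq (a • ∑ n, w n • p n) +
      sq (b • ∑ n, w n • p n + c • ∑ n, w' n • p n) + sq g := by
  have hw : w ≠ 0 := h.ne_zero 0
  have hpos := dotProduct_self_pos hw
  set z : Fin 3 → ℝ := w' - ((w ⬝ᵥ w') / (w ⬝ᵥ w)) • w with hz
  have hz0 : z ≠ 0 := by
    intro h0
    rw [LinearIndependent.pair_iff' hw] at h
    exact h _ (sub_eq_zero.mp h0).symm
  have hzpos := dotProduct_self_pos hz0
  have hwz : w ⬝ᵥ z = 0 := by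
    rw [hz, dotProduct_sub, dotProduct_smul, smul_eq_mul, div_mul_cancel₀ _ hpos.ne', sub_self]
  have hnorm : ∀ t : ℝ, 0 < t → (√t)⁻¹ * ((√t)⁻¹ * t) = 1 := fun t ht => by
    have := Real.mul_self_sqrt ht.le
    have h0 := (Real.sqrt_pos.mpr ht).ne'
    field_simp
    linarith
  obtain ⟨g, hg⟩ := sumSq_eq_of_orthonormal p (u := (√(w ⬝ᵥ w))⁻¹ • w) (v := (√(z ⬝ᵥ z))⁻¹ • z)
    (by simpa using hnorm _ hpos) (by simpa using hnorm _ hzpos) (by simp [hwz])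
  refine ⟨(√(w ⬝ᵥ w))⁻¹, -((√(z ⬝ᵥ z))⁻¹ * ((w ⬝ᵥ w') / (w ⬝ᵥ w))), (√(z ⬝ᵥ z))⁻¹,
    inv_ne_zero (Real.sqrt_pos.mpr hpos).ne', g, ?_⟩
  rw [hg]
  congr 3
  · simp [Finset.smul_sum, smul_smul]
  · simp only [Fin.sum_univ_three, hz, Pi.smul_apply, Pi.sub_apply, smul_eq_mul]
    module

/-- The forms `(c x y)² + p² + q²`. -/
def degenerateA (t : ℝ × Quad × Quad) : Quart :=
  sq (t.1 • mulLin (Pi.single 0 1) (Pi.single 1 1)) + sq t.2.1 + sq t.2.2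

/-- The forms `(x m)² + (c x m + y n)² + p²` with `m`, `n` linear. -/
def degenerateB (t : (Fin 3 → ℝ) × ℝ × (Fin 3 → ℝ) × Quad) : Quart :=
  sq (mulLin (Pi.single 0 1) t.1) +
    sq (t.2.1 • mulLin (Pi.single 0 1) t.1 + mulLin (Pi.single 1 1) t.2.2.1) + sq t.2.2.2

/-- The `r`-th coordinate of a linear form. -/
def linCoeff (r : Fin 3) : Dual ℝ (Fin 3 → ℝ) := LinearMap.proj r

/-- The coefficient of the square of the `r`-th variable in a quadratic form. -/
def diagCoeff (r : Fin 3) : Dual ℝ Quad := LinearMap.proj (Fin.castLE (by norm_num) r)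

/-- The forms `g² + l² q` with `l` a linear form with `r`-th coordinate `1`, and `g` without
the square of the `r`-th variable. -/
def degenerateC (r : Fin 3)
    (t : LinearMap.ker (linCoeff r) × Quad × LinearMap.ker (diagCoeff r)) : Quart :=
  sq (t.2.2 : Quad) + mulQuad (mulLin (Pi.single r 1 + (t.1 : Fin 3 → ℝ)) (Pi.single r 1 + (t.1 : Fin 3 → ℝ)))
    t.2.1

lemma mem_range_degenerateA {p : Fin 3 → Quad} {w : Fin 3 → ℝ} (hw : w ≠ 0) {c : ℝ}
    (h : ∑ n, w n • p n = c • mulLin (Pi.single 0 1) (Pi.single 1 1)) :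
    sumSq p ∈ range degenerateA := by
  obtain ⟨w', hw'⟩ := exists_linearIndependent_pair_of_one_lt_finrank (R := ℝ)
    (M := Fin 3 → ℝ) (by simp) hw
  obtain ⟨a, b, d, -, g, hg⟩ := sumSq_eq_of_linearIndependent p hw'
  rw [h] at hg
  exact ⟨(a * c, _, g), by rw [hg, degenerateA, mul_smul]⟩

lemma mem_range_degenerateA_or_degenerateB {p : Fin 3 → Quad} {w w' m n : Fin 3 → ℝ}
    (hw : w ≠ 0) (hw' : w' ≠ 0) (h : ∑ n, w n • p n = mulLin (Pi.single 0 1) m)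
    (h' : ∑ n, w' n • p n = mulLin (Pi.single 1 1) n) :
    sumSq p ∈ range degenerateA ∪ range degenerateB := by
  by_cases hli : LinearIndependent ℝ ![w, w']
  · right
    obtain ⟨a, b, d, ha, g, hg⟩ := sumSq_eq_of_linearIndependent p hli
    rw [h, h'] at hg
    refine ⟨(a • m, b / a, d • n, g), ?_⟩
    simp only [degenerateB, map_smul]
    rw [hg, smul_smul, div_mul_cancel₀ _ ha]
  · left
    rw [LinearIndependent.pair_iff' hw] at hli
    push Not at hli
    obtain ⟨t, rfl⟩ := hli
    have ht : t ≠ 0 := by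
      rintro rfl
      simp at hw'
    refine mem_range_degenerateA hw (c := m 1) ?_
    rw [h]
    simp only [Pi.smul_apply, smul_assoc, ← Finset.smul_sum, h] at h'
    have h0 := congrFun h' 0
    have h5 := congrFun h' 5
    simp [mulLin_apply, ht] at h0 h5
    ext s
    fin_cases s <;> simp [mulLin_apply, h0, h5]

lemma mem_range_degenerateC {p : Fin 3 → Quad} {l m n : Fin 3 → ℝ} (hl : l ≠ 0)
    (hmn : LinearIndependent ℝ ![m, n]) (hm : mulLin l m ∈ Submodule.span ℝ (range p))
    (hn : mulLin l n ∈ Submodule.span ℝ (range p)) :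
    ∃ r, sumSq p ∈ range (degenerateC r) := by
  obtain ⟨w, hw⟩ := (Submodule.mem_span_range_iff_exists_fun ℝ).mp hm
  obtain ⟨w', hw'⟩ := (Submodule.mem_span_range_iff_exists_fun ℝ).mp hn
  have hli : LinearIndependent ℝ ![w, w'] := by
    rw [LinearIndependent.pair_iff] at hmn ⊢
    intro x y hxy
    apply hmn
    apply eq_zero_of_mulLin_eq_zero hl
    rw [map_add, map_smul, map_smul, ← hw, ← hw', Finset.smul_sum, Finset.smul_sum,
      ← Finset.sum_add_distrib]
    refine Finset.sum_eq_zero fun k _ => ?_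
    have := congrFun hxy k
    rw [smul_smul, smul_smul, ← add_smul]
    simp at this
    simp [this]
  obtain ⟨a, b, c, -, g, hg⟩ := sumSq_eq_of_linearIndependent p hli
  rw [hw, hw', ← map_smul, ← map_smul, ← map_smul, ← map_add, sq, sq, mulQuad_mulLin_swap,
    mulQuad_mulLin_swap l (b • m + c • n), ← map_add] at hg
  generalize mulLin (a • m) (a • m) + mulLin (b • m + c • n) (b • m + c • n) = q at hg
  obtain ⟨r, hr⟩ := Function.ne_iff.mp hl
  simp only [Pi.zero_apply] at hr
  refine ⟨r, ?_⟩
  set l' : Fin 3 → ℝ := (l r)⁻¹ • l with hl'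
  have hll : mulLin l l = (l r * l r) • mulLin l' l' := by
    rw [hl', map_smul, map_smul, LinearMap.smul_apply, smul_smul, smul_smul]
    field_simp
    simp
  have hl'r : l' r = 1 := by simp [hl', hr]
  have hd : diagCoeff r (mulLin l' l') = 1 := by
    have : diagCoeff r (mulLin l' l') = l' r * l' r := by
      fin_cases r <;> simp [diagCoeff, mulLin_apply]
    rw [this, hl'r, one_mul]
  set e := diagCoeff r g with he
  refine ⟨(⟨l' - Pi.single r 1, by simp [linCoeff, hl'r]⟩,
    (l r * l r) • q + (2 * e) • (g - e • mulLin l' l') + (e * e) • mulLin l' l',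
    ⟨g - e • mulLin l' l', by simp [hd, he]⟩), ?_⟩
  rw [hg, hll]
  simp only [degenerateC, sq, add_sub_cancel, map_add, map_sub, map_smul, LinearMap.sub_apply,
    LinearMap.smul_apply, mulQuad_comm g (mulLin l' l')]
  module

/-- Either some nontrivial combination of the `p n` is divisible by `xₖ`, or two independent
elements of their span share a linear factor. -/
lemma exists_divisible_or_common_factor {p : Fin 3 → Quad} {i j k : Fin 3} (hij : i ≠ j)
    (hik : i ≠ k) (hjk : j ≠ k) (idx : Fin 3 → Fin 6)
    (hidx : ∀ q : Quad, ∃ m, q = q (idx 0) • mulLin (Pi.single i 1) (Pi.single i 1) +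
      q (idx 1) • mulLin (Pi.single i 1) (Pi.single j 1) +
      q (idx 2) • mulLin (Pi.single j 1) (Pi.single j 1) - mulLin (Pi.single k 1) m)
    (hzero : ∀ v : Fin 3 → ℝ, (∀ n, evalQuad (p n) v = 0) → v = 0)
    {L : Quart →ₗ[ℝ] ℝ} (hL : L ≠ 0) (hLp : ∀ n h, L (mulQuad (p n) h) = 0) :
    (∃ w m : Fin 3 → ℝ, w ≠ 0 ∧ ∑ n, w n • p n = mulLin (Pi.single k 1) m) ∨
      ∃ l : Fin 3 → ℝ, l ≠ 0 ∧ ∃ m n : Fin 3 → ℝ, LinearIndependent ℝ ![m, n] ∧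
        mulLin l m ∈ Submodule.span ℝ (range p) ∧ mulLin l n ∈ Submodule.span ℝ (range p) := by
  let M : Matrix (Fin 3) (Fin 3) ℝ := Matrix.of fun n c => p n (idx c)
  by_cases hM : M.det = 0
  · left
    obtain ⟨w, hw, h⟩ := exists_vecMul_eq_zero_iff.mpr hM
    have hc : ∀ c, (∑ n, w n • p n) (idx c) = 0 := fun c => by
      simpa [M, vecMul, dotProduct] using congrFun h c
    obtain ⟨m, hm⟩ := hidx (∑ n, w n • p n)
    exact ⟨w, -m, hw, by rw [hm, hc, hc, hc]; simp⟩
  · right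
    have hc : ∀ c d, (∑ n, M⁻¹ c n • p n) (idx d) = (1 : Matrix (Fin 3) (Fin 3) ℝ) c d :=
      fun c d => by
        rw [← Matrix.nonsing_inv_mul M (isUnit_iff_ne_zero.mpr hM)]
        simp [M, Matrix.mul_apply]
    have hp : ∀ n, p n = ∑ c, M n c • ∑ s, M⁻¹ c s • p s := fun n => by
      simp only [Finset.smul_sum, smul_smul]
      rw [Finset.sum_comm]
      simp only [← Finset.sum_smul, ← Matrix.mul_apply,
        Matrix.mul_nonsing_inv M (isUnit_iff_ne_zero.mpr hM)]
      simp [Matrix.one_apply]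
    have hmem : ∀ c, ∑ n, M⁻¹ c n • p n ∈ Submodule.span ℝ (range p) := fun c =>
      (Submodule.mem_span_range_iff_exists_fun ℝ).mpr ⟨_, rfl⟩
    obtain ⟨a, ha⟩ := hidx (∑ n, M⁻¹ 0 n • p n)
    obtain ⟨b, hb⟩ := hidx (∑ n, M⁻¹ 1 n • p n)
    obtain ⟨c, hcc⟩ := hidx (∑ n, M⁻¹ 2 n • p n)
    simp only [hc] at ha hb hcc
    simp at ha hb hcc
    refine exists_common_factor hij hik hjk (a := a) (b := b) (c := c)
      (ha ▸ hmem 0) (hb ▸ hmem 1) (hcc ▸ hmem 2) (fun v h1 h2 h3 => hzero v fun n => ?_) hL ?_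
    · have hev : ∀ d e f, e * f = v k * (d ⬝ᵥ v) → ∀ u u' : Fin 3 → ℝ, u ⬝ᵥ v = e → u' ⬝ᵥ v = f →
          evalQuad (mulLin u u' - mulLin (Pi.single k 1) d) v = 0 := by
        intro d e f h u u' hu hu'
        rw [sub_eq_add_neg, ← neg_one_smul ℝ, evalQuad_add, evalQuad_smul, evalQuad_mulLin,
          evalQuad_mulLin, hu, hu', h]
        simp
      rw [hp n, Fin.sum_univ_three, ha, hb, hcc, evalQuad_add, evalQuad_add, evalQuad_smul,
        evalQuad_smul, evalQuad_smul, hev a _ _ h1, hev b _ _ h2, hev c _ _ h3] <;> simp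
    · intro q hq h
      obtain ⟨w, rfl⟩ := (Submodule.mem_span_range_iff_exists_fun ℝ).mp hq
      simp [hLp]

/-- The quartic forms for which the argument by continuity breaks down. -/
def degenerate : Set Quart :=
  range degenerateA ∪ range degenerateB ∪ ⋃ r, range (degenerateC r)

lemma sumSq_mem_degenerate {p : Fin 3 → Quad}
    (hzero : ∀ v : Fin 3 → ℝ, (∀ n, evalQuad (p n) v = 0) → v = 0)
    {L : Quart →ₗ[ℝ] ℝ} (hL : L ≠ 0) (hLp : ∀ n h, L (mulQuad (p n) h) = 0) :
    sumSq p ∈ degenerate := by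
  have hC : (∃ l : Fin 3 → ℝ, l ≠ 0 ∧ ∃ m n : Fin 3 → ℝ, LinearIndependent ℝ ![m, n] ∧
        mulLin l m ∈ Submodule.span ℝ (range p) ∧ mulLin l n ∈ Submodule.span ℝ (range p)) →
      sumSq p ∈ degenerate := by
    rintro ⟨l, hl, m, n, hmn, hm, hn⟩
    exact Or.inr (mem_iUnion.mpr (mem_range_degenerateC hl hmn hm hn))
  have h0 := exists_divisible_or_common_factor (p := p) (i := 1) (j := 2) (k := 0) (by decide)
    (by decide) (by decide) ![1, 4, 2]
    (fun q => ⟨-![q 0, q 3, q 5], by ext s; fin_cases s <;> simp [mulLin_apply]⟩) hzero hL hLp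
  have h1 := exists_divisible_or_common_factor (p := p) (i := 0) (j := 2) (k := 1) (by decide)
    (by decide) (by decide) ![0, 5, 2]
    (fun q => ⟨-![q 3, q 1, q 4], by ext s; fin_cases s <;> simp [mulLin_apply]⟩) hzero hL hLp
  rcases h0 with ⟨w, m, hw, h⟩ | h
  · rcases h1 with ⟨w', n, hw', h'⟩ | h1
    · exact Or.inl (mem_range_degenerateA_or_degenerateB hw hw' h h')
    · exact hC h1
  · exact hC h

end Degenerate

section Topology

/-- The Fermat quartic `x⁴ + y⁴ + z⁴`. -/
def fermat : Quart := ![1, 1, 1, 0, 0, 0, 0, 0, 0, 0, 0, 0, 0, 0, 0]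

lemma evalQuart_fermat (v : Fin 3 → ℝ) : evalQuart fermat v = v 0 ^ 4 + v 1 ^ 4 + v 2 ^ 4 := by
  simp [evalQuart, fermat]

lemma evalQuart_fermat_pos {v : Fin 3 → ℝ} (hv : v ≠ 0) : 0 < evalQuart fermat v := by
  rw [evalQuart_fermat]
  obtain ⟨i, hi⟩ := Function.ne_iff.mp hv
  have hi : v i ≠ 0 := hi
  have h0 := Even.pow_nonneg (by decide : Even 4) (v 0)
  have h1 := Even.pow_nonneg (by decide : Even 4) (v 1)
  have h2 := Even.pow_nonneg (by decide : Even 4) (v 2)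
  have h := Even.pow_pos (by decide : Even 4) hi
  fin_cases i <;> simp at h <;> linarith

lemma evalQuart_sumSq (p : Fin 3 → Quad) (v : Fin 3 → ℝ) :
    evalQuart (sumSq p) v = ∑ n, evalQuad (p n) v ^ 2 := by
  simp only [sumSq, sq, Fin.sum_univ_three, evalQuart_add, evalQuart_mulQuad, pow_two]

lemma contDiff_mulLin {E : Type*} [NormedAddCommGroup E] [NormedSpace ℝ E] {f g : E → Fin 3 → ℝ}
    (hf : ContDiff ℝ 1 f) (hg : ContDiff ℝ 1 g) : ContDiff ℝ 1 fun x => mulLin (f x) (g x) :=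
  mulLin.toContinuousBilinearMap.isBoundedBilinearMap.contDiff.comp (hf.prodMk hg)

lemma contDiff_mulQuad {E : Type*} [NormedAddCommGroup E] [NormedSpace ℝ E] {f g : E → Quad}
    (hf : ContDiff ℝ 1 f) (hg : ContDiff ℝ 1 g) : ContDiff ℝ 1 fun x => mulQuad (f x) (g x) :=
  mulQuad.toContinuousBilinearMap.isBoundedBilinearMap.contDiff.comp (hf.prodMk hg)

lemma contDiff_sq {E : Type*} [NormedAddCommGroup E] [NormedSpace ℝ E] {f : E → Quad}
    (hf : ContDiff ℝ 1 f) : ContDiff ℝ 1 fun x => sq (f x) := contDiff_mulQuad hf hf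

lemma contDiff_degenerateA : ContDiff ℝ 1 degenerateA :=
  ((contDiff_sq (contDiff_fst.smul contDiff_const)).add
    (contDiff_sq (contDiff_fst.comp contDiff_snd))).add
    (contDiff_sq (contDiff_snd.comp contDiff_snd))

lemma contDiff_degenerateB : ContDiff ℝ 1 degenerateB := by
  have h := contDiff_mulLin contDiff_const (contDiff_fst (𝕜 := ℝ) (n := 1) (E := Fin 3 → ℝ)
    (F := ℝ × (Fin 3 → ℝ) × Quad)) (f := fun _ => Pi.single 0 1)
  refine ((contDiff_sq h).add (contDiff_sq (((contDiff_fst.comp contDiff_snd).smul h).add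
    (contDiff_mulLin contDiff_const ?_)))).add (contDiff_sq ?_)
  · fun_prop
  · fun_prop

lemma contDiff_degenerateC (r : Fin 3) : ContDiff ℝ 1 (degenerateC r) := by
  have h : ContDiff ℝ 1 fun t : LinearMap.ker (linCoeff r) × Quad × LinearMap.ker (diagCoeff r) =>
      Pi.single r 1 + (t.1 : Fin 3 → ℝ) :=
    contDiff_const.add ((LinearMap.ker (linCoeff r)).subtypeL.contDiff.comp contDiff_fst)
  have h' : ContDiff ℝ 1 fun t : LinearMap.ker (linCoeff r) × Quad × LinearMap.ker (diagCoeff r) =>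
      (t.2.2 : Quad) :=
    (LinearMap.ker (diagCoeff r)).subtypeL.contDiff.comp (contDiff_snd.comp contDiff_snd)
  exact (contDiff_sq h').add
    (contDiff_mulQuad (contDiff_mulLin h h) (contDiff_fst.comp contDiff_snd))

/-- The union of the lines joining the Fermat quartic to the points of a set. -/
def cone (T : Set Quart) : Set Quart := {F | ∃ t : ℝ, ∃ G ∈ T, F = fermat + t • (G - fermat)}

lemma cone_union (S T : Set Quart) : cone (S ∪ T) = cone S ∪ cone T := by
  ext F
  simp only [cone, mem_union, mem_ofPred_eq, or_and_right, exists_or]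

lemma cone_iUnion (S : Fin 3 → Set Quart) : cone (⋃ r, S r) = ⋃ r, cone (S r) := by
  ext F
  simp only [cone, mem_iUnion, mem_ofPred_eq]
  tauto

lemma dimH_cone_range_le {E : Type*} [NormedAddCommGroup E] [NormedSpace ℝ E]
    [FiniteDimensional ℝ E] {B : E → Quart} (hB : ContDiff ℝ 1 B) (hE : finrank ℝ E ≤ 13) :
    dimH (cone (range B)) ≤ (14 : ℕ) := by
  have hcone : cone (range B) = range fun s : ℝ × E => fermat + s.1 • (B s.2 - fermat) := by
    ext F
    simp [cone, eq_comm]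
  have hdiff : ContDiff ℝ 1 fun s : ℝ × E => fermat + s.1 • (B s.2 - fermat) :=
    contDiff_const.add (contDiff_fst.smul ((hB.comp contDiff_snd).sub contDiff_const))
  rw [hcone]
  refine hdiff.dimH_range_le.trans (Nat.cast_le.mpr ?_)
  simp only [finrank_prod, finrank_self]
  omega

lemma dense_compl_cone_degenerate : Dense (cone degenerate)ᶜ := by
  apply dense_compl_of_dimH_lt_finrank
  rw [degenerate, cone_union, cone_union, cone_iUnion, dimH_union, dimH_union, dimH_iUnion]
  refine lt_of_le_of_lt (b := ((14 : ℕ) : ENNReal)) (max_le (max_le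
    (dimH_cone_range_le contDiff_degenerateA (by simp))
    (dimH_cone_range_le contDiff_degenerateB (by simp)))
    (iSup_le fun r => dimH_cone_range_le (contDiff_degenerateC r) ?_))
    (Nat.cast_lt.mpr (by simp))
  have h1 : finrank ℝ (LinearMap.ker (linCoeff r)) + 1 = 3 := by
    rw [Dual.finrank_ker_add_one_of_ne_zero, finrank_fin_fun]
    intro h
    simpa [linCoeff] using congrArg (fun L : Dual ℝ (Fin 3 → ℝ) => L (Pi.single r 1)) h
  have h2 : finrank ℝ (LinearMap.ker (diagCoeff r)) + 1 = 6 := by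
    rw [Dual.finrank_ker_add_one_of_ne_zero, finrank_fin_fun]
    intro h
    simpa [diagCoeff] using congrArg (fun L : Dual ℝ Quad =>
      L (Pi.single (Fin.castLE (by norm_num) r) 1)) h
  simp only [finrank_prod, finrank_fin_fun]
  omega

lemma contDiff_sumSq : ContDiff ℝ 1 sumSq :=
  ContDiff.sum fun n _ => contDiff_sq (contDiff_apply ℝ Quad n)

lemma norm_sq_le_norm_sumSq (p : Fin 3 → Quad) : ‖p‖ ^ 2 ≤ 9 * ‖sumSq p‖ := by
  have hc : ∀ q : Quad, ∀ i, q i ^ 2 ≤ 2 * sq q 0 + 2 * sq q 1 + 2 * sq q 2 + sq q 9 + sq q 10 +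
      sq q 11 := by
    intro q i
    have h : 2 * sq q 0 + 2 * sq q 1 + 2 * sq q 2 + sq q 9 + sq q 10 + sq q 11 =
        (q 0 + q 1 + q 2) ^ 2 + q 0 ^ 2 + q 1 ^ 2 + q 2 ^ 2 + q 3 ^ 2 + q 4 ^ 2 + q 5 ^ 2 := by
      simp [sq, mulQuad_apply]; ring
    rw [h]
    have h0 := sq_nonneg (q 0 + q 1 + q 2)
    have hq := fun j => sq_nonneg (q j)
    have h1 := hq 0
    have h2 := hq 1
    have h3 := hq 2
    have h4 := hq 3
    have h5 := hq 4
    have h6 := hq 5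
    fin_cases i <;> simp <;> linarith
  have hn : ∀ i, sumSq p i ≤ ‖sumSq p‖ := fun i =>
    (le_abs_self _).trans (norm_le_pi_norm (sumSq p) i)
  have hp : ∀ n i, p n i ^ 2 ≤ 9 * ‖sumSq p‖ := by
    intro n i
    refine (hc (p n) i).trans ((Finset.single_le_sum (f := fun m => 2 * sq (p m) 0 +
      2 * sq (p m) 1 + 2 * sq (p m) 2 + sq (p m) 9 + sq (p m) 10 + sq (p m) 11)
      (fun m _ => (sq_nonneg _).trans (hc (p m) 0)) (Finset.mem_univ n)).trans ?_)
    have h0 := hn 0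
    have h1 := hn 1
    have h2 := hn 2
    have h9 := hn 9
    have h10 := hn 10
    have h11 := hn 11
    simp only [sumSq, Finset.sum_apply, Fin.sum_univ_three] at h0 h1 h2 h9 h10 h11 ⊢
    linarith
  rw [← Real.le_sqrt (norm_nonneg _) (by positivity)]
  exact (pi_norm_le_iff_of_nonneg (Real.sqrt_nonneg _)).mpr fun n =>
    (pi_norm_le_iff_of_nonneg (Real.sqrt_nonneg _)).mpr fun i => Real.abs_le_sqrt (hp n i)

lemma isClosed_range_sumSq : IsClosed (range sumSq) := by
  refine (isProperMap_iff_tendsto_cocompact.mpr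
    ⟨contDiff_sumSq.continuous, ?_⟩).isClosedMap.isClosed_range
  rw [← Metric.cobounded_eq_cocompact, ← Metric.cobounded_eq_cocompact,
    ← tendsto_norm_atTop_iff_cobounded]
  refine tendsto_atTop_mono (fun p => ?_)
    (((tendsto_pow_atTop two_ne_zero).comp tendsto_norm_cobounded_atTop).atTop_div_const
      (by norm_num : (0 : ℝ) < 9))
  rw [Function.comp_apply, div_le_iff₀' (by norm_num)]
  exact norm_sq_le_norm_sumSq p

lemma range_sumSq_mem_nhds (p : Fin 3 → Quad)
    (h : ∀ L : Quart →ₗ[ℝ] ℝ, (∀ n h, L (mulQuad (p n) h) = 0) → L = 0) :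
    range sumSq ∈ 𝓝 (sumSq p) := by
  let B := mulQuad.toContinuousBilinearMap
  let π : Fin 3 → (Fin 3 → Quad) →L[ℝ] Quad := ContinuousLinearMap.proj
  have hd : HasStrictFDerivAt sumSq (∑ n, (B.precompR _ (p n) (π n) + B.precompL _ (π n) (p n))) p :=
    HasStrictFDerivAt.fun_sum fun n _ => B.hasStrictFDerivAt_of_bilinear
      (π n).hasStrictFDerivAt (π n).hasStrictFDerivAt
  rw [← hd.map_nhds_eq_of_surj]
  · exact range_mem_map
  · by_contra hne
    obtain ⟨L, hL, hker⟩ := Submodule.exists_le_ker_of_lt_top _ (lt_top_iff_ne_top.mpr hne)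
    refine hL (h L fun n q => ?_)
    have := hker (LinearMap.mem_range_self _ (Pi.single n q))
    have hs : ∀ m, mulQuad (p m) (Pi.single (M := fun _ => Quad) n q m) +
        mulQuad (Pi.single (M := fun _ => Quad) n q m) (p m) =
        Pi.single (M := fun _ => Quart) n ((2 : ℝ) • mulQuad (p n) q) m := by
      intro m
      obtain rfl | hm := eq_or_ne m n
      · simp [mulQuad_comm q, two_smul]
      · simp [hm]
    simpa [B, π, hs] using this

lemma eq_zero_of_vanish_squares (L : Quart →ₗ[ℝ] ℝ)
    (h : ∀ n h, L (mulQuad (mulLin (Pi.single n 1) (Pi.single n 1)) h) = 0) : L = 0 := by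
  refine LinearMap.ext fun f => ?_
  have hf : f = mulQuad (mulLin (Pi.single 0 1) (Pi.single 0 1)) ![f 0, f 9, f 11, f 3, f 12, f 4] +
      mulQuad (mulLin (Pi.single 1 1) (Pi.single 1 1)) ![0, f 1, f 10, f 5, f 6, f 13] +
      mulQuad (mulLin (Pi.single 2 1) (Pi.single 2 1)) ![0, 0, f 2, f 14, f 8, f 7] := by
    ext i
    fin_cases i <;> simp [mulLin_apply, mulQuad_apply]
  rw [hf, map_add, map_add, h, h, h]
  simp

lemma sumSq_squares : sumSq (fun n => mulLin (Pi.single n 1) (Pi.single n 1)) = fermat := by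
  ext i
  fin_cases i <;> simp [sumSq, sq, fermat, mulLin_apply, mulQuad_apply, Fin.sum_univ_three]

lemma mem_range_sumSq_of_notMem_cone {f : Quart} (hf : ∀ v ≠ 0, 0 < evalQuart f v)
    (hc : f ∉ cone degenerate) : f ∈ range sumSq := by
  let γ : ℝ → Quart := fun t => fermat + t • (f - fermat)
  have hγ : Continuous γ := by fun_prop
  have hsub : Icc (0 : ℝ) 1 ⊆ γ ⁻¹' range sumSq := by
    refine IsClosed.Icc_subset_of_forall_mem_nhdsWithin
      ((isClosed_range_sumSq.preimage hγ).inter isClosed_Icc)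
      ⟨_, by simpa [γ] using sumSq_squares⟩ fun t ht => ?_
    refine mem_nhdsWithin_of_mem_nhds (hγ.continuousAt.preimage_mem_nhds ?_)
    obtain ⟨⟨p, hp⟩, ht0, ht1⟩ := ht
    obtain rfl | ht0 := ht0.eq_or_lt
    · have : γ 0 = fermat := by simp [γ]
      rw [this, ← sumSq_squares]
      exact range_sumSq_mem_nhds _ eq_zero_of_vanish_squares
    rw [← hp]
    refine range_sumSq_mem_nhds p fun L hL => ?_
    by_contra hL0
    have hdeg : γ t ∈ degenerate := by
      rw [← hp]
      refine sumSq_mem_degenerate (fun v hv => ?_) hL0 hL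
      by_contra hv0
      have h0 : evalQuart (γ t) v = 0 := by
        rw [← hp, evalQuart_sumSq]
        simp [hv]
      have h1 : γ t = (1 - t) • fermat + t • f := by
        simp only [γ]
        module
      rw [h1, evalQuart_add, evalQuart_smul, evalQuart_smul] at h0
      have h2 := mul_pos (sub_pos.mpr ht1) (evalQuart_fermat_pos hv0)
      have h3 := mul_pos ht0 (hf v hv0)
      linarith
    refine hc ⟨t⁻¹, γ t, hdeg, ?_⟩
    simp [γ, smul_smul, ht0.ne']
  have := hsub ⟨zero_le_one, le_rfl⟩
  simpa [γ] using this

lemma neg_le_evalQuart (f : Quart) (v : Fin 3 → ℝ) :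
    -(15 * (‖f‖ * evalQuart fermat v)) ≤ evalQuart f v := by
  have hle : ‖v‖ ^ 4 ≤ evalQuart fermat v := by
    obtain ⟨i, hi⟩ := (Finite.exists_max fun i => ‖v i‖)
    have hv : ‖v‖ ≤ ‖v i‖ := (pi_norm_le_iff_of_nonneg (norm_nonneg _)).mpr hi
    refine (pow_le_pow_left₀ (norm_nonneg _) hv 4).trans ?_
    rw [Real.norm_eq_abs, Even.pow_abs (by decide), evalQuart_fermat]
    have h0 := Even.pow_nonneg (by decide : Even 4) (v 0)
    have h1 := Even.pow_nonneg (by decide : Even 4) (v 1)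
    have h2 := Even.pow_nonneg (by decide : Even 4) (v 2)
    fin_cases i <;> simp <;> linarith
  have hmon : ∀ (n : Fin 15) (i j k l : Fin 3), -(‖f‖ * ‖v‖ ^ 4) ≤ f n * (v i * v j * v k * v l) := by
    intro n i j k l
    refine neg_le_of_abs_le ?_
    rw [abs_mul, abs_mul, abs_mul, abs_mul]
    have h : ∀ i, |v i| ≤ ‖v‖ := norm_le_pi_norm v
    calc |f n| * (|v i| * |v j| * |v k| * |v l|) ≤ ‖f‖ * (‖v‖ * ‖v‖ * ‖v‖ * ‖v‖) := by
          gcongr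
          exacts [norm_le_pi_norm f n, h i, h j, h k, h l]
      _ = ‖f‖ * ‖v‖ ^ 4 := by ring
  have := mul_le_mul_of_nonneg_left hle (norm_nonneg f)
  refine le_trans (b := -(15 * (‖f‖ * ‖v‖ ^ 4))) (by linarith) ?_
  rw [evalQuart]
  linarith [hmon 0 0 0 0 0, hmon 1 1 1 1 1, hmon 2 2 2 2 2, hmon 3 0 0 0 1, hmon 4 0 0 0 2,
    hmon 5 1 1 1 0, hmon 6 1 1 1 2, hmon 7 2 2 2 0, hmon 8 2 2 2 1, hmon 9 0 0 1 1,
    hmon 10 1 1 2 2, hmon 11 0 0 2 2, hmon 12 0 0 1 2, hmon 13 0 1 1 2, hmon 14 0 1 2 2]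

/-- Every nonnegative quartic form is a sum of three squares of quadratic forms. -/
lemma mem_range_sumSq {f : Quart} (hf : ∀ v, 0 ≤ evalQuart f v) : f ∈ range sumSq := by
  rw [← isClosed_range_sumSq.closure_eq, Metric.mem_closure_iff]
  intro ε hε
  set δ := ε / (2 * ‖fermat‖ + 2) with hδ
  have hfermat := norm_nonneg fermat
  have hδ0 : 0 < δ := by positivity
  obtain ⟨F, hF, hdist⟩ := dense_compl_cone_degenerate.exists_dist_lt (f + δ • fermat)
    (by positivity : 0 < min (δ / 15) (ε / 2))
  rw [dist_comm, dist_eq_norm] at hdist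
  refine ⟨F, mem_range_sumSq_of_notMem_cone (fun v hv => ?_) hF, ?_⟩
  · have hpos := evalQuart_fermat_pos hv
    have h1 := neg_le_evalQuart (F - (f + δ • fermat)) v
    have h2 : F = (F - (f + δ • fermat)) + (f + δ • fermat) := by abel
    rw [h2, evalQuart_add, evalQuart_add, evalQuart_smul]
    have h3 := mul_lt_mul_of_pos_right (hdist.trans_le (min_le_left _ _)) hpos
    linarith [hf v]
  · have h1 : F - f = (F - (f + δ • fermat)) + δ • fermat := by abel
    rw [dist_comm, dist_eq_norm, h1]
    refine (norm_add_le _ _).trans_lt ?_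
    rw [norm_smul, Real.norm_of_nonneg hδ0.le]
    have h2 := hdist.trans_le (min_le_right _ _)
    have h3 : δ * (2 * ‖fermat‖ + 2) = ε := div_mul_cancel₀ _ (by positivity)
    linarith

end Topology

section Polynomial

lemma exists_eval_eq_evalQuart {f : MvPolynomial (Fin 3) ℝ} (hf : f.IsHomogeneous 4) :
    ∃ F : Quart, ∀ v, eval v f = evalQuart F v := by
  have hmon : ∀ i j k : ℕ, i + j + k = 4 →
      ∃ F : Quart, ∀ v : Fin 3 → ℝ, v 0 ^ i * v 1 ^ j * v 2 ^ k = evalQuart F v := by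
    intro i j k h
    refine ⟨fun n => if ![![4, 0, 0], ![0, 4, 0], ![0, 0, 4], ![3, 1, 0], ![3, 0, 1], ![1, 3, 0],
      ![0, 3, 1], ![1, 0, 3], ![0, 1, 3], ![2, 2, 0], ![0, 2, 2], ![2, 0, 2], ![2, 1, 1],
      ![1, 2, 1], ![1, 1, 2]] n = ![i, j, k] then 1 else 0, fun v => ?_⟩
    have hi : i ≤ 4 := by omega
    have hj : j ≤ 4 := by omega
    obtain rfl : k = 4 - i - j := by omega
    interval_cases i <;> interval_cases j <;> simp at h <;> simp [evalQuart, mul_comm]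
  have hterm : ∀ d ∈ f.support, ∃ F : Quart, ∀ v, coeff d f * ∏ i, v i ^ d i = evalQuart F v := by
    intro d hd
    have hdeg := hf (mem_support_iff.mp hd)
    rw [Finsupp.weight_apply, Finsupp.sum_fintype _ _ (by simp), Fin.sum_univ_three] at hdeg
    obtain ⟨F, hF⟩ := hmon (d 0) (d 1) (d 2) (by simpa using hdeg)
    exact ⟨coeff d f • F, fun v => by rw [evalQuart_smul, ← hF, Fin.prod_univ_three]⟩
  choose! F hF using hterm
  refine ⟨∑ d ∈ f.support, F d, fun v => ?_⟩
  have hsum : ∀ s : Finset (Fin 3 →₀ ℕ), evalQuart (∑ d ∈ s, F d) v = ∑ d ∈ s, evalQuart (F d) v :=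
    fun s => map_sum (AddMonoidHom.mk' (fun G => evalQuart G v) fun G H => evalQuart_add G H v) F s
  rw [hsum, eval_eq']
  exact Finset.sum_congr rfl fun d hd => hF d hd v

lemma exists_homogeneous_eval_eq_evalQuad (q : Quad) :
    ∃ g : MvPolynomial (Fin 3) ℝ, g.IsHomogeneous 2 ∧ ∀ v, eval v g = evalQuad q v := by
  have h : ∀ (c : ℝ) (i j : Fin 3), (C c * (X i * X j)).IsHomogeneous 2 := fun c i j =>
    ((isHomogeneous_X ℝ i).mul (isHomogeneous_X ℝ j)).C_mul c
  refine ⟨_, (((((h (q 0) 0 0).add (h (q 1) 1 1)).add (h (q 2) 2 2)).add (h (q 3) 0 1)).add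
    (h (q 4) 1 2)).add (h (q 5) 0 2), fun v => ?_⟩
  simp [evalQuad, pow_two]

end Polynomial

end TernaryQuartic

/-- Hilbert's theorem on ternary quartics: every positive semidefinite ternary
quartic form over ℝ is a sum of three squares of quadratic forms. -/
theorem hilbert_ternary_quartic
    (f : MvPolynomial (Fin 3) ℝ)
    (hf4 : f.IsHomogeneous 4)
    (hpsd : ∀ a : Fin 3 → ℝ, 0 ≤ eval a f) :
    ∃ q₁ q₂ q₃ : MvPolynomial (Fin 3) ℝ,
      q₁.IsHomogeneous 2 ∧ q₂.IsHomogeneous 2 ∧ q₃.IsHomogeneous 2 ∧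
      f = q₁ ^ 2 + q₂ ^ 2 + q₃ ^ 2 := by
  obtain ⟨F, hF⟩ := TernaryQuartic.exists_eval_eq_evalQuart hf4
  obtain ⟨p, rfl⟩ := TernaryQuartic.mem_range_sumSq fun v => hF v ▸ hpsd v
  choose g hg hgp using fun n => TernaryQuartic.exists_homogeneous_eval_eq_evalQuad (p n)
  refine ⟨g 0, g 1, g 2, hg 0, hg 1, hg 2, MvPolynomial.funext fun v => ?_⟩
  rw [hF, TernaryQuartic.evalQuart_sumSq, Fin.sum_univ_three]
  simp [hgp]
end

section
/- There exists a nonzero polynomial Ψ with real coefficients in 12 variables (the coefficients of a triple (f₂,f₃,f₄) of univariate real polynomials with deg f₂ ≤ 2, deg f₃ ≤ 3, deg f₄ ≤ 4) with the following property: for every triple (f₂,f₃,f₄) for which there exist ξ ∈ ℝ[x] with deg ξ ≤ 2, η ∈ ℝ[x] with deg η ≤ 3 and a real number t ≠ 0 such that η² = (f₂ − tξ)(4f₄ − ξ²) − f₃², and such that the polynomials g_t(ξ) = tξ³ − f₂ξ² − 4t f₄ ξ + 4f₂f₄ − f₃² and h_t(ξ) = 3tξ² − 2f₂ξ − 4t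 f₄ have a common irreducible quadratic factor in ℝ[x], the polynomial Ψ vanishes at the coefficient vector of (f₂,f₃,f₄). In other words, such triples are not Zariski dense in the space of all triples of the given degrees. -/
open Polynomial

/-- The coefficient vector in ℝ¹² of a triple `(f₂, f₃, f₄)` of univariate
polynomials with `deg f₂ ≤ 2`, `deg f₃ ≤ 3`, `deg f₄ ≤ 4`: the first 3
coordinates are the coefficients of `f₂`, the next 4 those of `f₃`, and the
last 5 those of `f₄`. -/
def coeffVec (f₂ f₃ f₄ : Polynomial ℝ) : Fin 12 → ℝ := fun i =>
  if (i : ℕ) < 3 then f₂.coeff i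
  else if (i : ℕ) < 7 then f₃.coeff ((i : ℕ) - 3)
  else f₄.coeff ((i : ℕ) - 7)

/-- The image of a polynomial map `ℝ¹¹ → ℝ¹²`, given by the coefficients of three polynomials over
`ℝ[v₀, …, v₁₀]`, is not Zariski dense. -/
lemma exists_eval_coeffVec_map_eq_zero (g₂ g₃ g₄ : Polynomial (MvPolynomial (Fin 11) ℝ)) :
    ∃ Ψ : MvPolynomial (Fin 12) ℝ, Ψ ≠ 0 ∧ ∀ v : Fin 11 → ℝ,
      MvPolynomial.eval (coeffVec (g₂.map (MvPolynomial.eval v)) (g₃.map (MvPolynomial.eval v))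
        (g₄.map (MvPolynomial.eval v))) Ψ = 0 := by
  set P : Fin 12 → MvPolynomial (Fin 11) ℝ := fun i =>
    if (i : ℕ) < 3 then g₂.coeff i
    else if (i : ℕ) < 7 then g₃.coeff ((i : ℕ) - 3)
    else g₄.coeff ((i : ℕ) - 7) with hP
  have hdep : ¬ AlgebraicIndependent ℝ P := fun h => by
    have hcard := h.cardinalMk_le_trdeg
    rw [MvPolynomial.trdeg_of_isDomain] at hcard
    simp only [Cardinal.mk_fin, Cardinal.lift_natCast] at hcard
    norm_cast at hcard
  rw [algebraicIndependent_iff] at hdep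
  push Not at hdep
  obtain ⟨Ψ, hΨ, hne⟩ := hdep
  refine ⟨Ψ, hne, fun v => ?_⟩
  have hv : coeffVec (g₂.map (MvPolynomial.eval v)) (g₃.map (MvPolynomial.eval v))
      (g₄.map (MvPolynomial.eval v)) = fun i => MvPolynomial.eval v (P i) := by
    funext i
    simp only [coeffVec, hP, coeff_map]
    split_ifs <;> rfl
  have h := congrArg (MvPolynomial.eval v) hΨ
  rw [MvPolynomial.aeval_def, MvPolynomial.hom_eval₂] at h
  rw [hv, ← MvPolynomial.eval₂_id]
  convert h using 1
  · congr 1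
    ext r
    simp
  · simp

section NormalForms

variable {K : Type*} [Field K]

lemma eq_quadratic_of_natDegree_le_two {q : K[X]} (hq : q.natDegree ≤ 2) :
    q = C (q.coeff 0) + C (q.coeff 1) * X + C (q.coeff 2) * X ^ 2 := by
  conv_lhs => rw [q.as_sum_range_C_mul_X_pow' (Nat.lt_succ_of_le hq)]
  simp [Finset.sum_range_succ]

lemma eq_linear_of_natDegree_le_one {q : K[X]} (hq : q.natDegree ≤ 1) :
    q = C (q.coeff 0) + C (q.coeff 1) * X := by
  conv_lhs => rw [q.as_sum_range_C_mul_X_pow' (Nat.lt_succ_of_le hq)]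
  simp [Finset.sum_range_succ]

lemma natDegree_le_of_monic_mul {p q : K[X]} (hp : p.Monic) {m n : ℕ} (hm : p.natDegree = m)
    (h : (p * q).natDegree ≤ m + n) : q.natDegree ≤ n := by
  rcases eq_or_ne q 0 with rfl | hq
  · simp
  · rw [hp.natDegree_mul' hq] at h
    omega

lemma natDegree_modByMonic_le_one {p : K[X]} (hp : p.Monic) (hp2 : p.natDegree = 2) (q : K[X]) :
    (q %ₘ p).natDegree ≤ 1 := by
  have := natDegree_modByMonic_lt q hp (by rintro rfl; simp at hp2)
  omega

/-- Normal form when the determinantal matrix vanishes modulo `p`. -/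
lemma exists_normalForm_of_dvd [CharZero K] {p ξ f₂ f₃ f₄ : K[X]} {t : K} (ht : t ≠ 0)
    (hp : Irreducible p) (hm : p.Monic) (hp2 : p.natDegree = 2)
    (h₂ : f₂.natDegree ≤ 2) (h₃ : f₃.natDegree ≤ 3) (h₄ : f₄.natDegree ≤ 4)
    (hg : p ^ 2 ∣ (f₂ - C t * ξ) * (4 * f₄ - ξ ^ 2) - f₃ ^ 2)
    (hh : p ∣ 2 * ξ * (f₂ - C t * ξ) + C t * (4 * f₄ - ξ ^ 2))
    (hA : p ∣ f₂ - C t * ξ) :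
    ∃ (r D E : K[X]) (a : K), r.natDegree ≤ 1 ∧ D.natDegree ≤ 1 ∧ E.natDegree ≤ 2 ∧
      f₂ = C a * p + C t * r ∧ f₃ = p * D ∧ f₄ = C (4 : K)⁻¹ * (p * E + r ^ 2) := by
  have h4 : (C (4 : K)⁻¹ : K[X]) * 4 = 1 := by
    rw [← C_ofNat (R := K), ← C_mul, inv_mul_cancel₀ (by norm_num), C_1]
  have hB : p ∣ 4 * f₄ - ξ ^ 2 := by
    have h := (dvd_add_right (hA.mul_left (2 * ξ))).1 hh
    exact (isUnit_C.2 ht.isUnit).dvd_mul_left.1 h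
  have hf₃ : p ∣ f₃ := by
    refine hp.prime.dvd_of_dvd_pow (n := 2) ?_
    exact (dvd_sub_right (hA.mul_right _)).1 ((dvd_pow_self p two_ne_zero).trans hg)
  have hdiv := modByMonic_add_div ξ p
  set r := ξ %ₘ p with hr
  have hr1 : r.natDegree ≤ 1 := natDegree_modByMonic_le_one hm hp2 ξ
  obtain ⟨a, ha⟩ : p ∣ f₂ - C t * r := by
    have : f₂ - C t * r = f₂ - C t * ξ + p * (C t * (ξ /ₘ p)) := by linear_combination -C t * hdiv
    rw [this]
    exact dvd_add hA (dvd_mul_right _ _)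
  obtain ⟨E, hE⟩ : p ∣ 4 * f₄ - r ^ 2 := by
    have : 4 * f₄ - r ^ 2 = 4 * f₄ - ξ ^ 2 + p * ((ξ /ₘ p) * (ξ + r)) := by
      linear_combination -(ξ + r) * hdiv
    rw [this]
    exact dvd_add hB (dvd_mul_right _ _)
  obtain ⟨D, rfl⟩ := hf₃
  have ha0 : a.natDegree ≤ 0 := by
    refine natDegree_le_of_monic_mul hm hp2 (ha ▸ ?_)
    compute_degree
    exact max_le h₂ (by omega)
  obtain ⟨a', rfl⟩ := natDegree_eq_zero.1 (Nat.le_zero.1 ha0)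
  refine ⟨r, D, E, a', hr1, natDegree_le_of_monic_mul hm hp2 h₃,
    natDegree_le_of_monic_mul hm hp2 (hE ▸ ?_), ?_, rfl, ?_⟩
  · compute_degree
    omega
  · linear_combination ha
  · linear_combination C (4 : K)⁻¹ * hE - f₄ * h4

/-- Normal form when the determinantal matrix has rank one modulo `p`. -/
lemma exists_normalForm_of_not_dvd [CharZero K] {p ξ f₂ f₃ f₄ : K[X]} {t : K} (ht : t ≠ 0)
    (hp : Irreducible p) (hm : p.Monic) (hp2 : p.natDegree = 2)
    (h₂ : f₂.natDegree ≤ 2) (h₃ : f₃.natDegree ≤ 3) (h₄ : f₄.natDegree ≤ 4)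
    (hg : p ^ 2 ∣ (f₂ - C t * ξ) * (4 * f₄ - ξ ^ 2) - f₃ ^ 2)
    (hh : p ∣ 2 * ξ * (f₂ - C t * ξ) + C t * (4 * f₄ - ξ ^ 2))
    (hA : ¬ p ∣ f₂ - C t * ξ) :
    ∃ (A w D : K[X]) (c s : K), A.natDegree ≤ 2 ∧ w.natDegree ≤ 1 ∧ D.natDegree ≤ 1 ∧
      f₂ = A - 2 * C s ^ 2 * w ^ 2 ∧ f₃ = w * A + p * D ∧
      f₄ = C (4 : K)⁻¹ * (w ^ 2 * A + 2 * w * p * D + C c * p ^ 2 + C s ^ 2 * w ^ 4) := by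
  have h4 : (C (4 : K)⁻¹ : K[X]) * 4 = 1 := by
    rw [← C_ofNat (R := K), ← C_mul, inv_mul_cancel₀ (by norm_num), C_1]
  have h2u : ¬ p ∣ (2 : K[X]) := fun h =>
    hp.not_isUnit (isUnit_of_dvd_unit h (by
      rw [← C_ofNat (R := K)]; exact isUnit_C.2 (IsUnit.mk0 _ two_ne_zero)))
  obtain ⟨s, rfl⟩ : ∃ s, t = 2 * s := ⟨t / 2, by ring⟩
  have hs : s ≠ 0 := right_ne_zero_of_mul ht
  have hsu : ¬ p ∣ C s := fun h =>
    hp.not_isUnit (isUnit_of_dvd_unit h (isUnit_C.2 hs.isUnit))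
  simp only [C_mul, C_ofNat] at hg hh hA
  obtain ⟨w, hw1, D₀, hD₀⟩ : ∃ w : K[X], w.natDegree ≤ 1 ∧ p ∣ f₃ - w * (f₂ - 2 * C s * ξ) := by
    obtain ⟨u, v, huv⟩ := (hp.coprime_iff_not_dvd.2 hA).symm
    refine ⟨(u * f₃) %ₘ p, natDegree_modByMonic_le_one hm hp2 _,
      v * f₃ + (u * f₃) /ₘ p * (f₂ - 2 * C s * ξ), ?_⟩
    have hdiv := modByMonic_add_div (u * f₃) p
    linear_combination -f₃ * huv - (f₂ - 2 * C s * ξ) * hdiv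
  obtain ⟨G, hG⟩ := hg
  obtain ⟨H, hH⟩ := hh
  obtain ⟨c, hc⟩ : p ∣ ξ + C s * w ^ 2 := by
    have h : p ∣ 2 * ((f₂ - 2 * C s * ξ) * ((f₂ - 2 * C s * ξ) * (ξ + C s * w ^ 2))) :=
      ⟨(f₂ - 2 * C s * ξ) * H - 2 * C s * p * G
        - 2 * C s * D₀ * (f₃ + w * (f₂ - 2 * C s * ξ)), by
        linear_combination (f₂ - 2 * C s * ξ) * hH - 2 * C s * hG
          - 2 * C s * (f₃ + w * (f₂ - 2 * C s * ξ)) * hD₀⟩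
    exact (hp.prime.dvd_or_dvd ((hp.prime.dvd_or_dvd ((hp.prime.dvd_or_dvd h).resolve_left
      h2u)).resolve_left hA)).resolve_left hA
  have hξ : ξ = p * c - C s * w ^ 2 := by linear_combination hc
  subst hξ
  obtain ⟨A, hAf⟩ : ∃ A, A = f₂ + C (2 * s ^ 2) * w ^ 2 := ⟨_, rfl⟩
  have hAdeg : A.natDegree ≤ 2 := by
    rw [hAf]
    compute_degree
    exact max_le h₂ (by omega)
  obtain rfl : f₂ = A - 2 * C s ^ 2 * w ^ 2 := by
    rw [hAf]; simp only [C_mul, C_pow, C_ofNat]; ring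
  clear hAf
  have hA' : ¬ p ∣ A := fun h => hA <| by
    have : A - 2 * C s ^ 2 * w ^ 2 - 2 * C s * (p * c - C s * w ^ 2)
        = A - p * (2 * C s * c) := by ring
    rw [this]
    exact dvd_sub h (dvd_mul_right _ _)
  obtain ⟨E, hE⟩ : p ∣ 4 * f₄ - C (s ^ 2) * w ^ 4 - w ^ 2 * A := by
    have h : p ∣ 2 * (C s * (4 * f₄ - C (s ^ 2) * w ^ 4 - w ^ 2 * A)) :=
      ⟨H - 2 * c * A + 4 * C s * c * (p * c - C s * w ^ 2)
        + 2 * C s * (p * c ^ 2 - 2 * c * C s * w ^ 2), by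
        rw [C_pow]; linear_combination hH⟩
    exact (hp.prime.dvd_or_dvd ((hp.prime.dvd_or_dvd h).resolve_left h2u)).resolve_left hsu
  obtain ⟨D, hD⟩ : p ∣ f₃ - w * A := ⟨D₀ - w * (2 * C s * c), by linear_combination hD₀⟩
  have hDdeg : D.natDegree ≤ 1 := by
    refine natDegree_le_of_monic_mul hm hp2 (hD ▸ ?_)
    compute_degree
    exact max_le h₃ (by omega)
  have hEdeg : E.natDegree ≤ 2 := by
    refine natDegree_le_of_monic_mul hm hp2 (hE ▸ ?_)
    compute_degree
    omega
  obtain ⟨k, hk⟩ : p ∣ E - 2 * w * D := by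
    refine (hp.prime.dvd_or_dvd (a := A) ?_).resolve_left hA'
    refine ⟨G + c * H - c ^ 2 * (A - 2 * C s * p * c)
      + 4 * C s * (p * c - C s * w ^ 2) * c ^ 2 - 2 * C s * p * c ^ 3 + D ^ 2, ?_⟩
    rw [C_pow] at hE
    refine mul_left_cancel₀ hp.ne_zero ?_
    linear_combination hG + p * c * hH - A * hE + (f₃ + w * A + p * D) * hD
  have hkdeg : k.natDegree ≤ 0 := by
    refine natDegree_le_of_monic_mul hm hp2 (hk ▸ ?_)
    compute_degree
    omega
  obtain ⟨k', rfl⟩ := natDegree_eq_zero.1 (Nat.le_zero.1 hkdeg)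
  refine ⟨A, w, D, k', s, hAdeg, hw1, hDdeg, rfl, ?_, ?_⟩
  · linear_combination hD
  · rw [C_pow] at hE
    linear_combination C (4 : K)⁻¹ * hE + C (4 : K)⁻¹ * p * hk - f₄ * h4

end NormalForms

/-- Proposition 1.1: the triples `(f₂,f₃,f₄)` admitting data `ξ, η, t` as in the
statement, such that `g_t(ξ)` and `h_t(ξ)` have a common irreducible quadratic
factor, are not Zariski dense: a single nonzero polynomial `Ψ` in the 12
coefficients vanishes on all of them. -/
theorem not_zariski_dense_triples :
    ∃ Ψ : MvPolynomial (Fin 12) ℝ, Ψ ≠ 0 ∧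
      ∀ f₂ f₃ f₄ : Polynomial ℝ,
        f₂.degree ≤ 2 → f₃.degree ≤ 3 → f₄.degree ≤ 4 →
        (∃ (ξ η : Polynomial ℝ) (t : ℝ), t ≠ 0 ∧
          ξ.degree ≤ 2 ∧ η.degree ≤ 3 ∧
          η ^ 2 = (f₂ - C t * ξ) * (4 * f₄ - ξ ^ 2) - f₃ ^ 2 ∧
          (∃ p : Polynomial ℝ, Irreducible p ∧ p.degree = 2 ∧
            p ∣ (C t * ξ ^ 3 - f₂ * ξ ^ 2 - C (4 * t) * f₄ * ξ
                  + 4 * f₂ * f₄ - f₃ ^ 2) ∧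
            p ∣ (C (3 * t) * ξ ^ 2 - 2 * f₂ * ξ - C (4 * t) * f₄))) →
        MvPolynomial.eval (coeffVec f₂ f₃ f₄) Ψ = 0 := by
  let a : Fin 11 → Polynomial (MvPolynomial (Fin 11) ℝ) := fun i => C (MvPolynomial.X i)
  let p : Polynomial (MvPolynomial (Fin 11) ℝ) := a 0 + a 1 * X + X ^ 2
  let D : Polynomial (MvPolynomial (Fin 11) ℝ) := a 2 + a 3 * X
  let w : Polynomial (MvPolynomial (Fin 11) ℝ) := a 4 + a 5 * X
  let A : Polynomial (MvPolynomial (Fin 11) ℝ) := a 6 + a 7 * X + a 8 * X ^ 2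
  let q : Polynomial (MvPolynomial (Fin 11) ℝ) := C (MvPolynomial.C (4 : ℝ)⁻¹)
  obtain ⟨Ψ₁, hΨ₁, h₁⟩ := exists_eval_coeffVec_map_eq_zero
    (a 9 * p + a 10 * w) (p * D) (q * (p * A + w ^ 2))
  obtain ⟨Ψ₂, hΨ₂, h₂⟩ := exists_eval_coeffVec_map_eq_zero
    (A - 2 * a 10 ^ 2 * w ^ 2) (w * A + p * D)
    (q * (w ^ 2 * A + 2 * w * p * D + a 9 * p ^ 2 + a 10 ^ 2 * w ^ 4))
  refine ⟨Ψ₁ * Ψ₂, mul_ne_zero hΨ₁ hΨ₂, ?_⟩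
  rintro f₂ f₃ f₄ hf₂ hf₃ hf₄ ⟨ξ, η, t, ht, -, -, hη, p₀, hp₀, hp₀deg, hpg, hph⟩
  obtain ⟨P, hP, hPm, hPdeg, hPp₀⟩ :
      ∃ P : ℝ[X], Irreducible P ∧ P.Monic ∧ P.natDegree = 2 ∧ P ∣ p₀ :=
    ⟨normalize p₀, (normalize_associated p₀).irreducible_iff.2 hp₀, monic_normalize hp₀.ne_zero,
      by rw [natDegree_eq_of_degree_eq degree_normalize, natDegree_eq_of_degree_eq_some hp₀deg],
      (normalize_associated p₀).dvd⟩
  have hg : P ^ 2 ∣ (f₂ - C t * ξ) * (4 * f₄ - ξ ^ 2) - f₃ ^ 2 := by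
    rw [← hη]
    refine pow_dvd_pow_of_dvd (hP.prime.dvd_of_dvd_pow (n := 2) ?_) 2
    refine (hPp₀.trans hpg).trans (dvd_of_eq ?_)
    rw [hη, C_mul, C_ofNat]
    ring
  have hh : P ∣ 2 * ξ * (f₂ - C t * ξ) + C t * (4 * f₄ - ξ ^ 2) := by
    refine (hPp₀.trans hph).trans (Dvd.intro (-1) ?_)
    rw [C_mul, C_mul, C_ofNat, C_ofNat]
    ring
  have hf₂' := natDegree_le_of_degree_le hf₂
  have hf₃' := natDegree_le_of_degree_le hf₃
  have hf₄' := natDegree_le_of_degree_le hf₄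
  have hPeq : P = C (P.coeff 0) + C (P.coeff 1) * X + X ^ 2 := by
    have hlead : P.coeff 2 = 1 := hPdeg ▸ hPm.coeff_natDegree
    conv_lhs => rw [eq_quadratic_of_natDegree_le_two hPdeg.le, hlead]
    simp
  rw [map_mul, mul_eq_zero]
  by_cases hA : P ∣ f₂ - C t * ξ
  · left
    obtain ⟨r, D', E, b, hr, hD, hE, rfl, rfl, rfl⟩ :=
      exists_normalForm_of_dvd ht hP hPm hPdeg hf₂' hf₃' hf₄' hg hh hA
    have h := h₁ ![P.coeff 0, P.coeff 1, D'.coeff 0, D'.coeff 1, r.coeff 0, r.coeff 1,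
      E.coeff 0, E.coeff 1, E.coeff 2, b, t]
    simp [a, p, D, w, A, q] at h
    rw [← hPeq, ← eq_linear_of_natDegree_le_one hD, ← eq_linear_of_natDegree_le_one hr,
      ← eq_quadratic_of_natDegree_le_two hE] at h
    exact h
  · right
    obtain ⟨A', w', D', c, s, hA', hw, hD, rfl, rfl, rfl⟩ :=
      exists_normalForm_of_not_dvd ht hP hPm hPdeg hf₂' hf₃' hf₄' hg hh hA
    have h := h₂ ![P.coeff 0, P.coeff 1, D'.coeff 0, D'.coeff 1, w'.coeff 0, w'.coeff 1,
      A'.coeff 0, A'.coeff 1, A'.coeff 2, c, s]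
    simp [a, p, D, w, A, q] at h
    rw [← hPeq, ← eq_linear_of_natDegree_le_one hD, ← eq_linear_of_natDegree_le_one hw,
      ← eq_quadratic_of_natDegree_le_two hA'] at h
    exact h
end

section
/- Let f₂, f₃, f₄, ξ ∈ ℝ[x], let t ∈ ℝ with t ≠ 0, set g_{ij} = i f_i f_j' − j f_j f_i' for i,j ∈ {2,3,4} and f₆ = 4f₂f₄ − f₃², and let p ∈ ℝ[x] be an irreducible quadratic polynomial. Assume: (i) p divides g_{24}² − g_{23}g_{34}; (ii) p divides none of g_{23}, g_{24}, g_{34}; (iii) g_{24}·(4f₄ − ξ²) ≡ 2 f₃ g_{34} (mod p); (iv) f₂ξ² + 8t f₄ ξ ≡ 3 f₆ (mod p); (v) f₆' ≡ f₂' ξ² + 4t f₄' ξ (mod p); (vi) f₆ is separable. Then p does not divide 2 f₂ g_{24} − f₃ g_{23}. -/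
open Polynomial

/-- Weighted Wronskians `u = g₂₃`, `v = g₂₄`, `w = g₃₄` satisfy a linear relation with the
functions `a, b, c`; if moreover `v² = uw` and `2av = bu`, then the discriminant vanishes. -/
theorem four_mul_sub_sq_eq_zero_of_wronskian_relations {F : Type*} [Field F]
    {a b c u v w : F} (h4 : (4 : F) ≠ 0) (hu : u ≠ 0)
    (hrel : 2 * a * w - 3 * b * v + 4 * c * u = 0) (hsq : v ^ 2 = u * w)
    (h : 2 * a * v = b * u) : 4 * a * c - b ^ 2 = 0 ∧ 4 * c * v = 2 * b * w := by
  obtain ⟨r, rfl⟩ : ∃ r, v = r * u := ⟨v / u, by field_simp⟩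
  obtain rfl : w = r ^ 2 * u := mul_left_cancel₀ hu (by linear_combination -hsq)
  obtain rfl : b = 2 * a * r := mul_right_cancel₀ hu (by linear_combination -h)
  obtain rfl : c = a * r ^ 2 :=
    mul_left_cancel₀ h4 (mul_right_cancel₀ hu (by linear_combination hrel))
  constructor <;> ring

/-- Step 1.6 of the paper: under the stated congruences modulo the irreducible
quadratic `p`, the polynomial `2 f₂ g₂₄ − f₃ g₂₃` is not divisible by `p`. -/
theorem not_dvd_two_f2_g24_sub_f3_g23
    (f₂ f₃ f₄ ξ : Polynomial ℝ) (t : ℝ) (ht : t ≠ 0)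
    (g₂₃ g₂₄ g₃₄ f₆ : Polynomial ℝ)
    (hg₂₃ : g₂₃ = 2 * f₂ * derivative f₃ - 3 * f₃ * derivative f₂)
    (hg₂₄ : g₂₄ = 2 * f₂ * derivative f₄ - 4 * f₄ * derivative f₂)
    (hg₃₄ : g₃₄ = 3 * f₃ * derivative f₄ - 4 * f₄ * derivative f₃)
    (hf₆ : f₆ = 4 * f₂ * f₄ - f₃ ^ 2)
    (p : Polynomial ℝ) (hp : Irreducible p) (hpdeg : p.degree = 2)
    (h1 : p ∣ g₂₄ ^ 2 - g₂₃ * g₃₄)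
    (h2 : ¬ p ∣ g₂₃) (h3 : ¬ p ∣ g₂₄) (h4 : ¬ p ∣ g₃₄)
    (h5 : p ∣ g₂₄ * (4 * f₄ - ξ ^ 2) - 2 * f₃ * g₃₄)
    (h6 : p ∣ f₂ * ξ ^ 2 + C (8 * t) * f₄ * ξ - 3 * f₆)
    (h7 : p ∣ derivative f₆ - (derivative f₂ * ξ ^ 2 + C (4 * t) * derivative f₄ * ξ))
    (h8 : f₆.Separable) :
    ¬ p ∣ 2 * f₂ * g₂₄ - f₃ * g₂₃ := by
  intro hdvd
  have : Fact (Irreducible p) := ⟨hp⟩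
  let φ := AdjoinRoot.mk p
  have hφ (q : ℝ[X]) : p ∣ q ↔ φ q = 0 := AdjoinRoot.mk_eq_zero.symm
  have h_four : (4 : AdjoinRoot p) ≠ 0 := by
    have := charZero_of_injective_algebraMap (algebraMap ℝ (AdjoinRoot p)).injective
    norm_num
  have hrel : 2 * f₂ * g₃₄ - 3 * f₃ * g₂₄ + 4 * f₄ * g₂₃ = 0 := by
    rw [hg₂₃, hg₂₄, hg₃₄]; ring
  replace hrel := congrArg φ hrel
  rw [hφ] at h1 h2 h3 h5 hdvd
  simp only [map_sub, map_add, map_mul, map_pow, map_ofNat, map_zero] at h1 h5 hdvd hrel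
  obtain ⟨hdisc, hcv⟩ := four_mul_sub_sq_eq_zero_of_wronskian_relations h_four h2 hrel
    (sub_eq_zero.mp h1) (sub_eq_zero.mp hdvd)
  have hξ : p ∣ ξ := by
    rw [hφ]
    have : φ g₂₄ * φ ξ ^ 2 = 0 := by linear_combination hcv - h5
    simpa [h3] using this
  have hf : p ∣ f₆ := by
    rw [hφ, hf₆]
    simpa only [map_sub, map_mul, map_pow, map_ofNat] using hdisc
  have hf' : p ∣ derivative f₆ := by
    refine (dvd_sub_left ?_).mp h7
    exact dvd_add ((hξ.pow two_ne_zero).mul_left _) (hξ.mul_left _)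
  exact hp.not_isUnit (h8.isUnit_of_dvd' hf hf')
end
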